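/- For every ε > 0 there exists a constant C = C(ε) such that for all real X ≥ 2 and all real H with 1 ≤ H ≤ X^{1/3 + ε}, the number of squarefree integers d ∈ [X, 2X) with h_3(-d) > H is at most C · X^ε · ( X^{1/2} + X^{7/2} H^{-10} ). -/

import Mathlib

/-- The imaginary quadratic field `ℚ(√-d)`, realized as the subfield of `ℂ`
generated over `ℚ` by `√d · i`. -/
noncomputable def Kneg (d : ℕ) : IntermediateField ℚ ℂ :=
  IntermediateField.adjoin ℚ {(Real.sqrt d : ℂ) * Complex.I}

/-- `hneg g d` is the `g`-part of the class number of `ℚ(√-d)`: the number of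
ideal classes `c` of the ring of integers of `ℚ(√-d)` with `c ^ g = 1`. -/
noncomputable def hneg (g d : ℕ) : ℕ :=
  Nat.card {c : ClassGroup (NumberField.RingOfIntegers (Kneg d)) // c ^ g = 1}

/-- The number of divisors of `n` is `O(n ^ ε)`. -/
theorem exists_card_divisors_le (ε : ℝ) (hε : 0 < ε) :
    ∃ C : ℝ, 1 ≤ C ∧ ∀ n : ℕ, n ≠ 0 → (n.divisors.card : ℝ) ≤ C * (n : ℝ) ^ ε := by
  set B : ℝ := max 1 (1 / (ε * Real.log 2)) with hB
  have hl2 : 0 < Real.log 2 := Real.log_pos (by norm_num)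
  have hB1 : 1 ≤ B := le_max_left _ _
  set N : ℕ := ⌈(2 : ℝ) ^ (1 / ε)⌉₊ with hN
  have key : ∀ p : ℕ, p.Prime → ∀ e : ℕ,
      ((e : ℝ) + 1) ≤ (if p < N then B else 1) * ((p : ℝ) ^ e) ^ ε := by
    intro p hp e
    have hp2 : (2 : ℝ) ≤ p := by exact_mod_cast hp.two_le
    have hp0 : (0 : ℝ) < p := by linarith
    split_ifs with h
    · have h1 : Real.exp (e * (ε * Real.log 2)) ≤ ((p : ℝ) ^ e) ^ ε := by
        rw [← Real.rpow_natCast, ← Real.rpow_mul hp0.le, Real.rpow_def_of_pos hp0]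
        apply Real.exp_le_exp.mpr
        have : Real.log 2 ≤ Real.log p := Real.log_le_log (by norm_num) hp2
        have h3 : Real.log 2 * (e * ε) ≤ Real.log p * (e * ε) := by gcongr
        linarith
      have h2 := Real.add_one_le_exp (e * (ε * Real.log 2))
      have h3 : (e : ℝ) + 1 ≤ B * (e * (ε * Real.log 2) + 1) := by
        have h4 : 1 ≤ B * (ε * Real.log 2) := by
          have : 1 / (ε * Real.log 2) ≤ B := le_max_right _ _
          rwa [div_le_iff₀ (by positivity)] at this
        have : (e : ℝ) * 1 ≤ e * (B * (ε * Real.log 2)) := by gcongr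
        linarith
      calc (e : ℝ) + 1 ≤ B * (e * (ε * Real.log 2) + 1) := h3
        _ ≤ B * ((p : ℝ) ^ e) ^ ε := by gcongr; linarith
    · have h1 : (2 : ℝ) ≤ (p : ℝ) ^ ε := by
        have : (2 : ℝ) ^ (1 / ε) ≤ p := (Nat.le_ceil _).trans (by exact_mod_cast not_lt.mp h)
        calc (2 : ℝ) = ((2 : ℝ) ^ (1 / ε)) ^ ε := by
              rw [← Real.rpow_mul (by norm_num), one_div_mul_cancel hε.ne', Real.rpow_one]
          _ ≤ _ := by gcongr
      rw [one_mul, ← Real.rpow_natCast, ← Real.rpow_mul hp0.le, mul_comm, Real.rpow_mul hp0.le,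
        Real.rpow_natCast]
      calc (e : ℝ) + 1 ≤ 2 ^ e := by exact_mod_cast Nat.succ_le_of_lt Nat.lt_two_pow_self
        _ ≤ _ := by gcongr
  refine ⟨B ^ N, one_le_pow₀ hB1, fun n hn => ?_⟩
  rw [Nat.card_divisors hn]
  have h1 : (n : ℝ) ^ ε = ∏ p ∈ n.primeFactors, ((p : ℝ) ^ n.factorization p) ^ ε := by
    rw [Real.finsetProd_rpow _ _ (fun p _ => by positivity)]
    congr 1
    conv_lhs => rw [← Nat.prod_factorization_pow_eq_self hn]
    rw [Finsupp.prod, Nat.support_factorization]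
    push_cast
    rfl
  push_cast
  calc ∏ p ∈ n.primeFactors, ((n.factorization p : ℝ) + 1)
      ≤ ∏ p ∈ n.primeFactors, ((if p < N then B else 1) *
          ((p : ℝ) ^ n.factorization p) ^ ε) :=
        Finset.prod_le_prod (fun _ _ => by positivity)
          fun p hp => key p (Nat.prime_of_mem_primeFactors hp) _
    _ = (∏ p ∈ n.primeFactors, (if p < N then B else 1)) * (n : ℝ) ^ ε := by
        rw [Finset.prod_mul_distrib, h1]
    _ ≤ B ^ N * (n : ℝ) ^ ε := by
        gcongr
        rw [Finset.prod_ite, Finset.prod_const_one, mul_one, Finset.prod_const]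
        apply pow_le_pow_right₀ hB1
        calc _ ≤ (Finset.range N).card := Finset.card_le_card (by intro p; simp)
          _ = N := Finset.card_range N

/-- The number of cube roots of unity modulo `m`. -/
theorem card_cube_roots_of_unity_le (m : ℕ) (hm : m ≠ 0) :
    Nat.card {x : (ZMod m)ˣ // x ^ 3 = 1} ≤ m.divisors.card ^ 2 := by
  induction m using Nat.recOnPosPrimePosCoprime with
  | zero => exact absurd rfl hm
  | one => simp
  | prime_pow p n hp hn =>
    rw [Nat.divisors_prime_pow hp, Finset.card_map, Finset.card_range]
    have h4 : 3 ≤ (n + 1) ^ 2 := by nlinarith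
    have : NeZero (p ^ n) := ⟨hm⟩
    refine le_trans ?_ h4
    by_cases h2 : p = 2
    · subst h2
      have : Subsingleton {x : (ZMod (2 ^ n))ˣ // x ^ 3 = 1} := by
        constructor
        rintro ⟨x, hx⟩ ⟨y, hy⟩
        have aux : ∀ z : (ZMod (2 ^ n))ˣ, z ^ 3 = 1 → z = 1 := by
          intro z hz
          have h1 : orderOf z ∣ 3 := orderOf_dvd_of_pow_eq_one hz
          have h3 : orderOf z ∣ 2 ^ (n - 1) := by
            have := orderOf_dvd_card (x := z)
            rw [ZMod.card_units_eq_totient, Nat.totient_prime_pow hp hn] at this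
            simpa using this
          have : orderOf z ∣ Nat.gcd 3 (2 ^ (n - 1)) := Nat.dvd_gcd h1 h3
          rw [Nat.Coprime.pow_right (n - 1) (by norm_num : Nat.Coprime 3 2)] at this
          exact orderOf_eq_one_iff.mp (Nat.dvd_one.mp this)
        rw [Subtype.mk.injEq, aux x hx, aux y hy]
      exact (Finite.card_le_one_iff_subsingleton.mpr this).trans (by norm_num)
    · have : IsCyclic (ZMod (p ^ n))ˣ := ZMod.isCyclic_units_of_prime_pow p hp h2 n
      classical
      have := IsCyclic.card_pow_eq_one_le (α := (ZMod (p ^ n))ˣ) (n := 3) (by norm_num)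
      rw [Nat.card_eq_fintype_card, Fintype.card_subtype]
      exact this
  | coprime a b ha hb hab iha ihb =>
    rw [Nat.Coprime.card_divisors_mul hab, mul_pow]
    refine le_trans ?_ (Nat.mul_le_mul (iha (by omega)) (ihb (by omega)))
    rw [← Nat.card_prod]
    have : NeZero a := ⟨by omega⟩
    have : NeZero b := ⟨by omega⟩
    let e : (ZMod (a * b))ˣ ≃* (ZMod a)ˣ × (ZMod b)ˣ :=
      (Units.mapEquiv (ZMod.chineseRemainder hab).toMulEquiv).trans MulEquiv.prodUnits
    refine Nat.card_le_card_of_injective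
      (fun x => (⟨(e x.1).1, ?_⟩, ⟨(e x.1).2, ?_⟩)) ?_
    · have := congrArg (fun z => (e z).1) x.2
      simpa using this
    · have := congrArg (fun z => (e z).2) x.2
      simpa using this
    · rintro ⟨x, hx⟩ ⟨y, hy⟩ hxy
      simp only [Prod.mk.injEq, Subtype.mk.injEq] at hxy
      rw [Subtype.mk.injEq]
      exact e.injective (Prod.ext hxy.1 hxy.2)

/-- The solutions `x ≤ N` of a congruence `x ^ 3 ≡ c` modulo `m`. -/
theorem card_filter_cube_congr_le (m N : ℕ) (hm : m ≠ 0) (S : Finset ℕ)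
    (hS : ∀ x ∈ S, x ≤ N ∧ x.Coprime m)
    (h : ∀ x ∈ S, ∀ y ∈ S, (m : ℤ) ∣ (x : ℤ) ^ 3 - (y : ℤ) ^ 3) :
    S.card ≤ m.divisors.card ^ 2 * (N / m + 1) := by
  classical
  rcases S.eq_empty_or_nonempty with rfl | ⟨x₀, hx₀⟩
  · simp
  have : NeZero m := ⟨hm⟩
  refine le_trans ?_ (Nat.mul_le_mul_right _ (card_cube_roots_of_unity_le m hm))
  have hc : (Finset.range (N / m + 1)).card = N / m + 1 := Finset.card_range _
  rw [Nat.card_eq_fintype_card, ← Finset.card_univ, ← hc, ← Finset.card_product]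
  let u : ℕ → (ZMod m)ˣ := fun x => if hx : x.Coprime m then ZMod.unitOfCoprime x hx else 1
  have hu : ∀ x ∈ S, (u x : ZMod m) = x := by
    intro x hx
    simp only [u, dif_pos (hS x hx).2, ZMod.coe_unitOfCoprime]
  have hroot : ∀ x ∈ S, (u x * (u x₀)⁻¹) ^ 3 = 1 := by
    intro x hx
    have h1 := h x hx x₀ hx₀
    rw [← ZMod.intCast_zmod_eq_zero_iff_dvd] at h1
    push_cast at h1
    have h2 : u x ^ 3 = u x₀ ^ 3 := by
      ext
      push_cast
      rw [hu x hx, hu x₀ hx₀]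
      exact sub_eq_zero.mp h1
    rw [mul_pow, h2, inv_pow, mul_inv_cancel]
  let f : ℕ → {z : (ZMod m)ˣ // z ^ 3 = 1} × ℕ := fun x =>
    (if hx : x ∈ S then ⟨u x * (u x₀)⁻¹, hroot x hx⟩ else ⟨1, one_pow 3⟩, x / m)
  refine Finset.card_le_card_of_injOn f ?_ ?_
  · intro x hx
    simp only [f, Finset.coe_product, Finset.coe_univ, Set.mem_prod, Set.mem_univ, true_and,
      Finset.coe_range, Set.mem_Iio]
    exact Nat.lt_succ_of_le (Nat.div_le_div_right (hS x hx).1)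
  · intro x hx y hy hxy
    have hx' : x ∈ S := hx
    have hy' : y ∈ S := hy
    simp only [f, hx', hy', dif_pos, Prod.mk.injEq, Subtype.mk.injEq, mul_left_inj] at hxy
    have h1 : (x : ZMod m) = y := by rw [← hu x hx', ← hu y hy', hxy.1]
    have h2 : x % m = y % m := (ZMod.natCast_eq_natCast_iff' x y m).mp h1
    rw [← Nat.div_add_mod x m, ← Nat.div_add_mod y m, hxy.2, h2]

open scoped NumberTheorySymbols in
/-- If some prime divides `r * m` exactly once, then `r * m` is not a quadratic residue modulo
some odd `b`. -/
theorem exists_jacobiSym_eq_neg_one {r m : ℕ} (hr : r.Prime) (hrm : ¬ r ∣ m) :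
    ∃ b : ℕ, Odd b ∧ J(((r * m : ℕ) : ℤ) | b) = -1 := by
  have hm0 : m ≠ 0 := by rintro rfl; exact hrm (dvd_zero r)
  obtain ⟨e, n, hn, hmn⟩ := Nat.exists_eq_two_pow_mul_odd hm0
  have hnb : ∀ b : ℕ, b % 4 = 1 → b ≡ 1 [MOD n] → J((n : ℤ) | b) = 1 := by
    intro b hb4 hb1
    rw [jacobiSym.quadratic_reciprocity_one_mod_four' hn hb4]
    have h1 : ((b : ℕ) : ℤ) % (n : ℤ) = 1 % (n : ℤ) := by
      have := hb1
      rw [Nat.ModEq] at this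
      exact_mod_cast this
    rw [jacobiSym.mod_left' h1, jacobiSym.one_left]
  rcases hr.eq_two_or_odd' with rfl | hodd
  · have he : e = 0 := by
      by_contra he
      exact hrm (hmn ▸ (dvd_pow_self 2 he).mul_right n)
    subst he
    rw [pow_zero, one_mul] at hmn
    subst hmn
    have hco : Nat.Coprime 8 m := by
      have : Nat.Coprime 2 m := Nat.coprime_two_left.mpr hn
      exact (Nat.Coprime.pow_left 3 this : Nat.Coprime (2 ^ 3) m)
    obtain ⟨b, hb8, hbm⟩ := Nat.chineseRemainder hco 5 1
    have hb8' : b % 8 = 5 := hb8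
    have hbo : Odd b := Nat.odd_iff.mpr (by omega)
    refine ⟨b, hbo, ?_⟩
    have h2 : J(2 | b) = -1 := by
      have := jacobiSym.even_odd (a := 2) (b := b) (by norm_num) (by omega)
      rw [if_pos (Or.inr hb8')] at this
      rw [← this]
      norm_num [jacobiSym.one_left]
    push_cast
    rw [jacobiSym.mul_left, h2, hnb b (by omega) hbm, mul_one]
  · have : Fact r.Prime := ⟨hr⟩
    have hr2 : ringChar (ZMod r) ≠ 2 := by
      rw [ZMod.ringChar_zmod_n]
      rintro rfl
      exact absurd hodd (by decide)
    obtain ⟨a, ha⟩ := FiniteField.exists_nonsquare hr2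
    have hco : Nat.Coprime (8 * n) r := by
      apply Nat.Coprime.mul_left
      · exact (Nat.Coprime.pow_left 3 (Nat.coprime_two_left.mpr hodd) : Nat.Coprime (2 ^ 3) r)
      · rw [Nat.coprime_comm, hr.coprime_iff_not_dvd]
        exact fun h => hrm (hmn ▸ h.mul_left _)
    obtain ⟨b, hb8, hbr⟩ := Nat.chineseRemainder hco 1 a.val
    have hb8' : b % 8 = 1 := hb8.of_mul_right n
    have hbn : b ≡ 1 [MOD n] := hb8.of_mul_left 8
    have hbo : Odd b := Nat.odd_iff.mpr (by omega)
    refine ⟨b, hbo, ?_⟩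
    have h2 : J(2 | b) = 1 := by
      have := jacobiSym.even_odd (a := 2) (b := b) (by norm_num) (by omega)
      rw [if_neg (by omega)] at this
      rw [← this]
      norm_num [jacobiSym.one_left]
    have h3 : J((r : ℤ) | b) = -1 := by
      rw [jacobiSym.quadratic_reciprocity_one_mod_four' hodd (by omega),
        ZMod.nonsquare_iff_jacobiSym_eq_neg_one]
      have : (b : ZMod r) = a := by
        rw [(ZMod.natCast_eq_natCast_iff _ _ _).mpr hbr, ZMod.natCast_zmod_val]
      push_cast
      rwa [this]
    rw [hmn]
    push_cast
    rw [jacobiSym.mul_left, jacobiSym.mul_left, jacobiSym.pow_left, h2, h3,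
      hnb b (by omega) hbn, one_pow, mul_one, mul_one]

open scoped NumberTheorySymbols in
theorem exists_jacobiSym_mul_eq_neg_one {d d' : ℕ} (hd : Squarefree d) (hd' : Squarefree d')
    (hne : d ≠ d') : ∃ b : ℕ, Odd b ∧ J(((d * d' : ℕ) : ℤ) | b) = -1 := by
  have aux : ∀ x y : ℕ, Squarefree x → ∀ r : ℕ, r.Prime → r ∣ x → ¬ r ∣ y →
      ∃ b : ℕ, Odd b ∧ J(((x * y : ℕ) : ℤ) | b) = -1 := by
    rintro x y hx r hr ⟨z, rfl⟩ hy
    rw [mul_assoc]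
    refine exists_jacobiSym_eq_neg_one hr ?_
    rw [hr.dvd_mul, not_or]
    refine ⟨fun h => ?_, hy⟩
    exact hr.one_lt.ne' (Nat.isUnit_iff.mp (hx r (mul_dvd_mul_left r h)))
  by_cases h : ∀ r : ℕ, r.Prime → (r ∣ d ↔ r ∣ d')
  · exact absurd ((Nat.Squarefree.ext_iff hd hd').mpr h) hne
  · push Not at h
    obtain ⟨r, hr, ⟨h1, h2⟩ | ⟨h1, h2⟩⟩ := h
    · exact aux d d' hd r hr h1 h2
    · rw [mul_comm]
      exact aux d' d hd' r hr h2 h1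

open scoped NumberTheorySymbols in
/-- The trivial bound for incomplete sums of a nonprincipal real character. -/
theorem abs_sum_jacobiSym_le {D b₀ : ℕ} (hD : D ≠ 0) (hb₀ : Odd b₀) (h : J((D : ℤ) | b₀) = -1)
    (N : ℕ) : |∑ n ∈ (Finset.range N).filter Odd, J((D : ℤ) | n)| ≤ 4 * D := by
  set T := 4 * D with hT
  have hTpos : 0 < T := by omega
  have hTe : Even T := ⟨2 * D, by omega⟩
  set f : ℕ → ℤ := fun n => if Odd n then J((D : ℤ) | n) else 0 with hf
  have hmod : ∀ n, f (n % T) = f n := by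
    intro n
    have h1 : Odd (n % T) ↔ Odd n := by
      rw [Nat.odd_iff, Nat.odd_iff, Nat.mod_mod_of_dvd _ hTe.two_dvd]
    simp only [hf, h1]
    split_ifs with hn
    · rw [jacobiSym.mod_right' D hn]
    · rfl
  have hmul : ∀ n, f (n * b₀) = - f n := by
    intro n
    have h1 : Odd (n * b₀) ↔ Odd n := by simp [Nat.odd_mul, hb₀]
    simp only [hf, h1]
    split_ifs with hn
    · rw [jacobiSym.mul_right' _ hn.pos.ne' hb₀.pos.ne', h, mul_neg_one]
    · simp
  have hco : Nat.Coprime T b₀ := by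
    apply Nat.Coprime.mul_left
    · exact (Nat.Coprime.pow_left 2 (Nat.coprime_two_left.mpr hb₀) : Nat.Coprime (2 ^ 2) b₀)
    · by_contra hc
      have := (jacobiSym.eq_zero_iff (a := (D : ℤ))).mpr
        ⟨hb₀.pos.ne', fun h' => hc (by simpa using h')⟩
      omega
  have hfull : ∑ n ∈ Finset.range T, f n = 0 := by
    have hmaps : Set.MapsTo (fun n => n * b₀ % T) (Finset.range T) (Finset.range T) := by
      intro n _
      simpa using Nat.mod_lt _ hTpos
    have hinj : Set.InjOn (fun n => n * b₀ % T) (Finset.range T : Set ℕ) := by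
      intro x hx y hy hxy
      have hx' : x < T := by simpa using hx
      have hy' : y < T := by simpa using hy
      have h1 : x ≡ y [MOD T] := Nat.ModEq.cancel_right_of_coprime hco hxy
      exact Nat.ModEq.eq_of_lt_of_lt h1 hx' hy'
    have h1 : ∑ n ∈ Finset.range T, f (n * b₀) = ∑ n ∈ Finset.range T, f n := by
      refine Finset.sum_nbij (fun n => n * b₀ % T) hmaps hinj
        (Finset.surjOn_of_injOn_of_card_le _ hmaps hinj le_rfl) ?_
      intro n _
      rw [hmod]
    simp only [hmul, Finset.sum_neg_distrib] at h1
    omega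
  have hper : ∀ q r : ℕ, ∑ n ∈ Finset.range (T * q + r), f n = ∑ n ∈ Finset.range r, f n := by
    intro q r
    induction q with
    | zero => simp
    | succ q ih =>
      rw [show T * (q + 1) + r = T + (T * q + r) by ring, Finset.sum_range_add, hfull, zero_add,
        ← ih]
      refine Finset.sum_congr rfl fun n _ => ?_
      rw [← hmod, Nat.add_mod_left, hmod]
  rw [Finset.sum_filter, ← Nat.div_add_mod N T]
  change |∑ n ∈ Finset.range (T * (N / T) + N % T), f n| ≤ _
  rw [hper]
  have hf1 : ∀ n, |f n| ≤ 1 := by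
    intro n
    simp only [hf]
    split_ifs
    · rcases jacobiSym.trichotomy (D : ℤ) n with h | h | h <;> simp [h]
    · simp
  calc |∑ n ∈ Finset.range (N % T), f n| ≤ ∑ n ∈ Finset.range (N % T), |f n| :=
        Finset.abs_sum_le_sum_abs _ _
    _ ≤ ∑ n ∈ Finset.range (N % T), 1 := Finset.sum_le_sum fun n _ => hf1 n
    _ = ((N % T : ℕ) : ℤ) := by simp
    _ ≤ (T : ℤ) := by exact_mod_cast (Nat.mod_lt _ hTpos).le
    _ = _ := by rw [hT]; push_cast; ring

open scoped NumberTheorySymbols in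
theorem jacobiSym_prod_right {ι : Type*} (a : ℤ) (s : Finset ι) (g : ι → ℕ)
    (hg : ∀ i ∈ s, g i ≠ 0) : J(a | ∏ i ∈ s, g i) = ∏ i ∈ s, J(a | g i) := by
  classical
  induction s using Finset.induction_on with
  | empty => simp
  | insert i s hi ih =>
    rw [Finset.prod_insert hi, Finset.prod_insert hi, jacobiSym.mul_right', ih]
    · exact fun j hj => hg j (Finset.mem_insert_of_mem hj)
    · exact hg i (Finset.mem_insert_self i s)
    · exact Finset.prod_ne_zero_iff.mpr fun j hj => hg j (Finset.mem_insert_of_mem hj)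

/-- An integer is the product of few `k`-tuples of primes. -/
theorem card_prime_tuples_le (P : Finset ℕ) (hP : ∀ p ∈ P, p.Prime) (k n : ℕ) :
    ((Fintype.piFinset fun _ : Fin k => P).filter (fun x => ∏ i, x i = n)).card ≤ k ^ k := by
  set F := (Fintype.piFinset fun _ : Fin k => P).filter (fun x => ∏ i, x i = n) with hF
  rcases F.eq_empty_or_nonempty with h | ⟨x₀, hx₀⟩
  · simp [h]
  simp only [hF, Finset.mem_filter, Fintype.mem_piFinset] at hx₀
  have hsub : F ⊆ Fintype.piFinset fun _ : Fin k => Finset.univ.image x₀ := by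
    intro x hx
    simp only [hF, Finset.mem_filter, Fintype.mem_piFinset] at hx
    rw [Fintype.mem_piFinset]
    intro i
    have h1 : x i ∣ ∏ j, x₀ j := by
      rw [hx₀.2, ← hx.2]
      exact Finset.dvd_prod_of_mem x (Finset.mem_univ i)
    obtain ⟨j, -, hj⟩ := (Prime.dvd_finsetProd_iff (hP _ (hx.1 i)).prime x₀).mp h1
    rw [(Nat.prime_dvd_prime_iff_eq (hP _ (hx.1 i)) (hP _ (hx₀.1 j))).mp hj]
    exact Finset.mem_image_of_mem x₀ (Finset.mem_univ j)
  calc F.card ≤ _ := Finset.card_le_card hsub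
    _ = (Finset.univ.image x₀).card ^ k := by simp
    _ ≤ k ^ k := by
        gcongr
        exact Finset.card_image_le.trans (by simp)

open scoped NumberTheorySymbols in
/-- A large sieve inequality for the real characters `(-d / ·)`, in the range where the
off-diagonal terms may be bounded trivially. -/
theorem sum_sq_sum_jacobiSym_le (E : Finset ℕ) (D N : ℕ)
    (hE : ∀ d ∈ E, Squarefree d ∧ d ≤ D) (ε : ℕ → ℝ) (hε : ∀ d, |ε d| ≤ 1) :
    ∑ n ∈ (Finset.range N).filter Odd, (∑ d ∈ E, ε d * (J(-(d : ℤ) | n) : ℝ)) ^ 2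
      ≤ N * E.card + 4 * (D : ℝ) ^ 2 * (E.card : ℝ) ^ 2 := by
  have hJ : ∀ d d' n : ℕ, (J(-(d : ℤ) | n) : ℝ) * (J(-(d' : ℤ) | n) : ℝ)
      = (J(((d * d' : ℕ) : ℤ) | n) : ℝ) := by
    intro d d' n
    rw [← Int.cast_mul, ← jacobiSym.mul_left]
    congr 2
    push_cast
    ring
  have hin : ∀ d ∈ E, ∀ d' ∈ E,
      |∑ n ∈ (Finset.range N).filter Odd, (J(((d * d' : ℕ) : ℤ) | n) : ℝ)|
        ≤ (if d = d' then (N : ℝ) else 0) + 4 * (D : ℝ) ^ 2 := by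
    intro d hd d' hd'
    split_ifs with h
    · have : |∑ n ∈ (Finset.range N).filter Odd, (J(((d * d' : ℕ) : ℤ) | n) : ℝ)| ≤ N := by
        calc _ ≤ ∑ n ∈ (Finset.range N).filter Odd, |(J(((d * d' : ℕ) : ℤ) | n) : ℝ)| :=
              Finset.abs_sum_le_sum_abs _ _
          _ ≤ ∑ n ∈ (Finset.range N).filter Odd, (1 : ℝ) := by
              refine Finset.sum_le_sum fun n _ => ?_
              rcases jacobiSym.trichotomy ((d * d' : ℕ) : ℤ) n with h | h | h <;> rw [h] <;> simp
          _ = ((Finset.range N).filter Odd).card := by simp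
          _ ≤ N := by
              exact_mod_cast (Finset.card_filter_le _ _).trans (Finset.card_range N).le
      have : 0 ≤ 4 * (D : ℝ) ^ 2 := by positivity
      linarith
    · obtain ⟨b, hb, hJb⟩ := exists_jacobiSym_mul_eq_neg_one (hE d hd).1 (hE d' hd').1 h
      have h0 : d * d' ≠ 0 := mul_ne_zero (hE d hd).1.ne_zero (hE d' hd').1.ne_zero
      have h1 := abs_sum_jacobiSym_le h0 hb hJb N
      have h2 : ((d * d' : ℕ) : ℝ) ≤ (D : ℝ) ^ 2 := by
        rw [sq]
        exact_mod_cast Nat.mul_le_mul (hE d hd).2 (hE d' hd').2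
      have h3 : |∑ n ∈ (Finset.range N).filter Odd, (J(((d * d' : ℕ) : ℤ) | n) : ℝ)|
          ≤ 4 * ((d * d' : ℕ) : ℝ) := by exact_mod_cast h1
      linarith
  calc ∑ n ∈ (Finset.range N).filter Odd, (∑ d ∈ E, ε d * (J(-(d : ℤ) | n) : ℝ)) ^ 2
      = ∑ d ∈ E, ∑ d' ∈ E, ε d * ε d' *
          ∑ n ∈ (Finset.range N).filter Odd, (J(((d * d' : ℕ) : ℤ) | n) : ℝ) := by
        simp_rw [sq, Finset.sum_mul_sum, Finset.mul_sum]
        rw [Finset.sum_comm]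
        refine Finset.sum_congr rfl fun d _ => ?_
        rw [Finset.sum_comm]
        refine Finset.sum_congr rfl fun d' _ => Finset.sum_congr rfl fun n _ => ?_
        rw [← hJ]
        ring
    _ ≤ ∑ d ∈ E, ∑ d' ∈ E, ((if d = d' then (N : ℝ) else 0) + 4 * (D : ℝ) ^ 2) := by
        refine Finset.sum_le_sum fun d hd => Finset.sum_le_sum fun d' hd' => ?_
        refine (le_abs_self _).trans ?_
        rw [abs_mul, abs_mul]
        calc _ ≤ 1 * 1 * |∑ n ∈ (Finset.range N).filter Odd, (J(((d * d' : ℕ) : ℤ) | n) : ℝ)| := by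
              gcongr
              · exact hε d
              · exact hε d'
          _ ≤ _ := by rw [one_mul, one_mul]; exact hin d hd d' hd'
    _ = _ := by
        simp only [Finset.sum_add_distrib, Finset.sum_ite_eq, Finset.sum_const, nsmul_eq_mul]
        rw [← Finset.sum_filter]
        simp
        ring

open scoped NumberTheorySymbols in
/-- Few discriminants have a biased distribution of small split primes. -/
theorem card_biased_le (P E : Finset ℕ) (Y D k : ℕ) (m : ℝ) (hm : 0 ≤ m)
    (hP : ∀ p ∈ P, p.Prime ∧ Odd p ∧ p ≤ Y) (hE : ∀ d ∈ E, Squarefree d ∧ d ≤ D)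
    (hbig : ∀ d ∈ E, m ≤ |∑ p ∈ P, (J(-(d : ℤ) | p) : ℝ)|) :
    (E.card * m ^ k) ^ 2 ≤ (P.card : ℝ) ^ k * ((k : ℝ) ^ k *
      (((Y ^ k + 1 : ℕ) : ℝ) * E.card + 4 * (D : ℝ) ^ 2 * (E.card : ℝ) ^ 2)) := by
  set S : ℕ → ℝ := fun d => ∑ p ∈ P, (J(-(d : ℤ) | p) : ℝ) with hS
  set ε : ℕ → ℝ := fun d => if 0 ≤ S d ^ k then 1 else -1 with hεdef
  have hε : ∀ d, |ε d| ≤ 1 := by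
    intro d
    simp only [hεdef]
    split_ifs <;> simp
  have hεS : ∀ d, ε d * S d ^ k = |S d| ^ k := by
    intro d
    rw [← abs_pow]
    simp only [hεdef]
    split_ifs with h
    · rw [one_mul, abs_of_nonneg h]
    · rw [neg_one_mul, abs_of_neg (not_le.mp h)]
  set T := Fintype.piFinset fun _ : Fin k => P with hT
  have hTcard : T.card = P.card ^ k := by simp [hT]
  set c : ℕ → ℝ := fun n => ∑ d ∈ E, ε d * (J(-(d : ℤ) | n) : ℝ) with hc
  have hSk : ∀ d, S d ^ k = ∑ x ∈ T, (J(-(d : ℤ) | ∏ i, x i) : ℝ) := by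
    intro d
    simp only [hS]
    rw [Finset.sum_pow']
    refine Finset.sum_congr rfl fun x hx => ?_
    rw [jacobiSym_prod_right]
    · push_cast
      rfl
    · intro i _
      exact (hP _ (Fintype.mem_piFinset.mp hx i)).1.ne_zero
  have h1 : E.card * m ^ k ≤ ∑ x ∈ T, c (∏ i, x i) := by
    calc E.card * m ^ k = ∑ d ∈ E, m ^ k := by simp
      _ ≤ ∑ d ∈ E, ε d * S d ^ k := by
          refine Finset.sum_le_sum fun d hd => ?_
          rw [hεS]
          exact pow_le_pow_left₀ hm (hbig d hd) k
      _ = _ := by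
          simp only [hSk, hc, Finset.mul_sum]
          rw [Finset.sum_comm]
  have hmaps : ∀ x ∈ T, ∏ i, x i ∈ (Finset.range (Y ^ k + 1)).filter Odd := by
    intro x hx
    rw [Fintype.mem_piFinset] at hx
    rw [Finset.mem_filter, Finset.mem_range, Nat.lt_succ_iff]
    constructor
    · calc ∏ i, x i ≤ ∏ _i : Fin k, Y := Finset.prod_le_prod' fun i _ => (hP _ (hx i)).2.2
        _ = Y ^ k := by simp
    · exact Finset.prod_induction _ Odd (fun a b ha hb => ha.mul hb) odd_one
        fun i _ => (hP _ (hx i)).2.1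
  have h2 : ∑ x ∈ T, c (∏ i, x i) ^ 2 ≤
      (k : ℝ) ^ k * ∑ n ∈ (Finset.range (Y ^ k + 1)).filter Odd, c n ^ 2 := by
    rw [← Finset.sum_fiberwise_of_maps_to hmaps, Finset.mul_sum]
    refine Finset.sum_le_sum fun n _ => ?_
    calc ∑ x ∈ T.filter (fun x => ∏ i, x i = n), c (∏ i, x i) ^ 2
        = ∑ x ∈ T.filter (fun x => ∏ i, x i = n), c n ^ 2 :=
          Finset.sum_congr rfl fun x hx => by rw [(Finset.mem_filter.mp hx).2]
      _ = (T.filter (fun x => ∏ i, x i = n)).card * c n ^ 2 := by simp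
      _ ≤ (k : ℝ) ^ k * c n ^ 2 := by
          gcongr
          exact_mod_cast card_prime_tuples_le P (fun p hp => (hP p hp).1) k n
  calc (E.card * m ^ k) ^ 2 ≤ (∑ x ∈ T, c (∏ i, x i)) ^ 2 := by gcongr
    _ ≤ T.card * ∑ x ∈ T, c (∏ i, x i) ^ 2 := sq_sum_le_card_mul_sum_sq
    _ ≤ _ := by
        rw [hTcard]
        push_cast
        gcongr
        refine h2.trans ?_
        gcongr
        exact_mod_cast sum_sq_sum_jacobiSym_le E D (Y ^ k + 1) hE ε hε

/-- Two representations `4 p³ q³ = u² + d v²` and `4 p³ q'³ = u'² + d v'²` sharing the prime `p`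
yield a congruence for `p³` modulo the reduced coefficient `w = v / gcd(v, v')`. -/
theorem exists_congruence_of_two_representations {V d p q q' v v' : ℕ} {u u' : ℤ}
    (hp : p.Prime) (hq : q.Prime) (hq' : q'.Prime) (hp2 : p ≠ 2)
    (hVp : V < p) (hVq : V < q) (hpd : ¬ p ∣ d) (hqq' : q ≠ q')
    (hv : 0 < v) (hvV : v ≤ V) (hv' : 0 < v') (hvV' : v' ≤ V)
    (h : 4 * (p : ℤ) ^ 3 * (q : ℤ) ^ 3 = u ^ 2 + d * (v : ℤ) ^ 2)
    (h' : 4 * (p : ℤ) ^ 3 * (q' : ℤ) ^ 3 = u' ^ 2 + d * (v' : ℤ) ^ 2) :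
    ∃ g w w' : ℕ, ∃ b l : ℤ, 0 < g ∧ 0 < w ∧ 0 < w' ∧ g * w ≤ V ∧ g * w' = v' ∧
      p.Coprime w ∧ b * l = 4 * ((q' : ℤ) ^ 3 * (w : ℤ) ^ 2 - (q : ℤ) ^ 3 * (w' : ℤ) ^ 2) ∧
      b * l ≠ 0 ∧ Int.gcd w b ∣ 4 ∧ 2 * u' * w = l + (p : ℤ) ^ 3 * b := by
  have hpz : Prime (p : ℤ) := Nat.prime_iff_prime_int.mp hp
  obtain ⟨g, w, w', hg, hco, rfl, rfl⟩ := Nat.exists_coprime' (Nat.gcd_pos_of_pos_left v' hv)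
  have hw : 0 < w := Nat.pos_of_mul_pos_right hv
  have hw' : 0 < w' := Nat.pos_of_mul_pos_right hv'
  have hwV : w ≤ V := (Nat.le_mul_of_pos_right w hg).trans hvV
  have hnd : ∀ r x : ℕ, V < r → 0 < x → x ≤ V → ¬ r ∣ x := fun r x hr hx hxV hd =>
    absurd (Nat.le_of_dvd hx hd) (by omega)
  have hpu : ¬ (p : ℤ) ∣ u' := by
    intro hu
    have h1 : (p : ℤ) ∣ d * ((w' * g : ℕ) : ℤ) ^ 2 := by
      have h2 : (d : ℤ) * ((w' * g : ℕ) : ℤ) ^ 2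
          = p * (4 * (p : ℤ) ^ 2 * (q' : ℤ) ^ 3) - u' ^ 2 := by linear_combination -h'
      rw [h2]
      exact dvd_sub (dvd_mul_right _ _) (dvd_pow hu two_ne_zero)
    rcases hpz.dvd_or_dvd h1 with h2 | h2
    · exact hpd (by exact_mod_cast h2)
    · have := hpz.dvd_of_dvd_pow h2
      exact hnd p _ hVp hv' hvV' (by exact_mod_cast this)
  have hpw : ¬ (p : ℤ) ∣ w := fun hd => hnd p w hVp hw hwV (by exact_mod_cast hd)
  have hqw : q.Coprime w := (Nat.Prime.coprime_iff_not_dvd hq).mpr (hnd q w hVq hw hwV)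
  set M : ℤ := 4 * ((q' : ℤ) ^ 3 * (w : ℤ) ^ 2 - (q : ℤ) ^ 3 * (w' : ℤ) ^ 2) with hM
  have hprod : (u' * w - u * w') * (u' * w + u * w') = (p : ℤ) ^ 3 * M := by
    have hg2 : ((g : ℤ) ^ 2) ≠ 0 := by positivity
    apply mul_left_cancel₀ hg2
    push_cast at h h'
    rw [hM]
    linear_combination (g : ℤ) ^ 2 * (w' : ℤ) ^ 2 * h - (g : ℤ) ^ 2 * (w : ℤ) ^ 2 * h'
  have hM0 : M ≠ 0 := by
    intro h0
    have h1 : q' ^ 3 * w ^ 2 = q ^ 3 * w' ^ 2 := by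
      have : (q' : ℤ) ^ 3 * (w : ℤ) ^ 2 = (q : ℤ) ^ 3 * (w' : ℤ) ^ 2 := by
        rw [hM] at h0
        linarith
      exact_mod_cast this
    have h2 : q ∣ q' ^ 3 * w ^ 2 := h1 ▸ (dvd_pow_self q three_ne_zero).mul_right _
    rcases hq.dvd_mul.mp h2 with h3 | h3
    · exact hqq' ((Nat.prime_dvd_prime_iff_eq hq hq').mp (hq.dvd_of_dvd_pow h3))
    · exact hnd q w hVq hw hwV (hq.dvd_of_dvd_pow h3)
  have hsign : ∃ s : ℤ, (p : ℤ) ^ 3 ∣ u' * w - s * w' ∧ s ^ 2 = u ^ 2 := by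
    have h2 : ¬ ((p : ℤ) ∣ u' * w - u * w' ∧ (p : ℤ) ∣ u' * w + u * w') := by
      rintro ⟨h3, h4⟩
      have h5 := dvd_add h3 h4
      rw [show u' * w - u * w' + (u' * w + u * w') = 2 * (u' * w) by ring] at h5
      rcases hpz.dvd_or_dvd h5 with h6 | h6
      · have : p ∣ 2 := by exact_mod_cast h6
        exact hp2 ((Nat.prime_dvd_prime_iff_eq hp Nat.prime_two).mp this)
      · rcases hpz.dvd_or_dvd h6 with h7 | h7
        · exact hpu h7
        · exact hpw h7
    have h3 : (p : ℤ) ^ 3 ∣ (u' * w - u * w') * (u' * w + u * w') := hprod ▸ dvd_mul_right _ _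
    by_cases h4 : (p : ℤ) ∣ u' * w - u * w'
    · have h5 : ¬ (p : ℤ) ∣ u' * w + u * w' := fun h5 => h2 ⟨h4, h5⟩
      refine ⟨u, ?_, rfl⟩
      exact (((Prime.coprime_iff_not_dvd hpz).mpr h5).pow_left).dvd_of_dvd_mul_right h3
    · refine ⟨-u, ?_, by ring⟩
      have := (((Prime.coprime_iff_not_dvd hpz).mpr h4).pow_left (m := 3)).dvd_of_dvd_mul_left h3
      rw [show u' * w - -u * w' = u' * w + u * w' by ring]
      exact this
  obtain ⟨s, ⟨b, hb⟩, hs⟩ := hsign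
  have hbl : b * (u' * w + s * w') = M := by
    have hp3 : ((p : ℤ) ^ 3) ≠ 0 := pow_ne_zero 3 hpz.ne_zero
    apply mul_left_cancel₀ hp3
    rw [← mul_assoc, ← hb, ← hprod]
    linear_combination -(w' : ℤ) ^ 2 * hs
  refine ⟨g, w, w', b, u' * w + s * w', hg, hw, hw', by rwa [mul_comm], mul_comm _ _, ?_, hbl,
    by rwa [hbl], ?_, by linear_combination hb⟩
  · exact (Nat.Prime.coprime_iff_not_dvd hp).mpr (hnd p w hVp hw hwV)
  · set e := Int.gcd w b with he
    have hew : e ∣ w := by exact_mod_cast (Int.gcd_dvd_left (w : ℤ) b)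
    have heb : (e : ℤ) ∣ b := Int.gcd_dvd_right (w : ℤ) b
    have h1 : (e : ℤ) ∣ ((4 * q ^ 3 * w' ^ 2 : ℕ) : ℤ) := by
      have h2 : ((4 * q ^ 3 * w' ^ 2 : ℕ) : ℤ)
          = w * (4 * (q' : ℤ) ^ 3 * w) - b * (u' * w + s * w') := by
        rw [hbl, hM]
        push_cast
        ring
      rw [h2]
      exact dvd_sub ((Int.natCast_dvd_natCast.mpr hew).mul_right _) (heb.mul_right _)
    have h3 : e ∣ 4 * q ^ 3 * w' ^ 2 := by exact_mod_cast h1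
    have h4 : e.Coprime (w' ^ 2) := (Nat.Coprime.coprime_dvd_left hew hco).pow_right 2
    have h5 : e.Coprime (q ^ 3) := (Nat.Coprime.coprime_dvd_left hew hqw.symm).pow_right 3
    exact h5.dvd_of_dvd_mul_right (h4.dvd_of_dvd_mul_right h3)

theorem dvd_cube_sub_cube {w p₁ p₂ : ℕ} {b l x₁ x₂ : ℤ} (hw : 0 < w)
    (hg : Int.gcd w b ∣ 4) (h₁ : 2 * x₁ * w = l + (p₁ : ℤ) ^ 3 * b)
    (h₂ : 2 * x₂ * w = l + (p₂ : ℤ) ^ 3 * b) :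
    ((w / Nat.gcd w 4 : ℕ) : ℤ) ∣ (p₁ : ℤ) ^ 3 - (p₂ : ℤ) ^ 3 := by
  set Δ := (p₁ : ℤ) ^ 3 - (p₂ : ℤ) ^ 3 with hΔ
  have h3 : (w : ℤ) ∣ 4 * Δ := by
    obtain ⟨f, hf⟩ := hg
    have hbez := Int.gcd_eq_gcd_ab w b
    have h4 : (4 : ℤ) = (Int.gcd w b : ℤ) * f := by exact_mod_cast hf
    refine ⟨f * (Int.gcdA w b * Δ + Int.gcdB w b * (2 * x₁ - 2 * x₂)), ?_⟩
    rw [h4, hbez, hΔ]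
    linear_combination (-(f : ℤ) * Int.gcdB w b) * (h₁ - h₂)
  have h4 : w ∣ 4 * Δ.natAbs := by
    have := Int.natAbs_dvd_natAbs.mpr h3
    simpa [Int.natAbs_mul] using this
  have hgpos : 0 < Nat.gcd w 4 := Nat.gcd_pos_of_pos_left 4 hw
  have hco := Nat.coprime_div_gcd_div_gcd hgpos
  have h5 : w / Nat.gcd w 4 ∣ (4 / Nat.gcd w 4) * Δ.natAbs := by
    apply Nat.dvd_of_mul_dvd_mul_left hgpos
    rw [← mul_assoc, Nat.mul_div_cancel' (Nat.gcd_dvd_left w 4),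
      Nat.mul_div_cancel' (Nat.gcd_dvd_right w 4)]
    exact h4
  exact Int.natCast_dvd.mpr (hco.dvd_of_dvd_mul_left h5)

/-- The number of pairs `(d, p)` such that `p` occurs in two representations
`4 p³ q³ = u² + d v²` with distinct `q`. -/
theorem card_pairs_two_representations_le (Y V : ℕ) (hVY : V ≤ Y) (T : ℝ)
    (hT : ∀ n : ℕ, n ≠ 0 → n ≤ 8 * Y ^ 3 * V ^ 2 → (n.divisors.card : ℝ) ≤ T)
    (B : Finset (ℕ × ℕ))
    (hB : ∀ x ∈ B, ∃ q q' v v' : ℕ, ∃ u u' : ℤ, x.2.Prime ∧ q.Prime ∧ q'.Prime ∧ x.2 ≠ 2 ∧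
      V < x.2 ∧ V < q ∧ ¬ x.2 ∣ x.1 ∧ q ≠ q' ∧ x.2 ≤ Y ∧ q ≤ Y ∧ q' ≤ Y ∧
      0 < v ∧ v ≤ V ∧ 0 < v' ∧ v' ≤ V ∧
      4 * (x.2 : ℤ) ^ 3 * (q : ℤ) ^ 3 = u ^ 2 + x.1 * (v : ℤ) ^ 2 ∧
      4 * (x.2 : ℤ) ^ 3 * (q' : ℤ) ^ 3 = u' ^ 2 + x.1 * (v' : ℤ) ^ 2) :
    (B.card : ℝ) ≤ 10 * T ^ 3 * (Y : ℝ) ^ 3 * V * (∑ n ∈ Finset.Icc 1 V, (1 : ℝ) / n) ^ 2 := by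
  classical
  have hB' : ∀ x ∈ B, ∃ a : ℕ × ℕ × ℕ × ℕ × ℕ, ∃ b l u' : ℤ,
      0 < a.1 ∧ 0 < a.2.1 ∧ 0 < a.2.2.1 ∧ a.1 * a.2.1 ≤ V ∧ a.1 * a.2.2.1 ≤ V ∧
      x.2.Coprime a.2.1 ∧
      b * l = 4 * ((a.2.2.2.2 : ℤ) ^ 3 * (a.2.1 : ℤ) ^ 2 - (a.2.2.2.1 : ℤ) ^ 3 * (a.2.2.1 : ℤ) ^ 2)
      ∧ b * l ≠ 0 ∧ Int.gcd a.2.1 b ∣ 4 ∧ 2 * u' * a.2.1 = l + (x.2 : ℤ) ^ 3 * b ∧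
      4 * (x.2 : ℤ) ^ 3 * (a.2.2.2.2 : ℤ) ^ 3 = u' ^ 2 + x.1 * ((a.1 * a.2.2.1 : ℕ) : ℤ) ^ 2 ∧
      x.2 ≤ Y ∧ 0 < a.2.2.2.1 ∧ a.2.2.2.1 ≤ Y ∧ 0 < a.2.2.2.2 ∧ a.2.2.2.2 ≤ Y := by
    intro x hx
    obtain ⟨q, q', v, v', u, u', hp, hq, hq', hp2, hVp, hVq, hpd, hqq', hpY, hqY, hqY', hv, hvV,
      hv', hvV', h, h'⟩ := hB x hx
    obtain ⟨g, w, w', b, l, hg, hw, hw', hgw, hgw', hpw, hbl, hbl0, hgcd, hlin⟩ :=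
      exists_congruence_of_two_representations hp hq hq' hp2 hVp hVq hpd hqq' hv hvV hv' hvV' h h'
    exact ⟨(g, w, w', q, q'), b, l, u', hg, hw, hw', hgw, hgw'.trans_le hvV', hpw, hbl, hbl0, hgcd,
      hlin, by rw [hgw']; exact h', hpY, hq.pos, hqY, hq'.pos, hqY'⟩
  choose! a b l u' hg hw hw' hgw hgw' hpw hbl hbl0 hgcd hlin hrep hpY hq0 hqY hq0' hqY' using hB'
  have hT1 : ∀ n : ℕ, n ≠ 0 → n ≤ V → (n.divisors.card : ℝ) ≤ T := by
    intro n hn hnV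
    refine hT n hn ?_
    have hV : 1 ≤ V := by omega
    have hY : 1 ≤ Y := by omega
    have h1 : 1 ≤ Y ^ 3 := Nat.one_le_pow _ _ hY
    calc n ≤ 8 * 1 * V ^ 2 := by nlinarith
      _ ≤ _ := by gcongr
  set I : Finset (ℕ × ℕ × ℕ × ℕ × ℕ) := ((Finset.Icc 1 V) ×ˢ (Finset.Icc 1 V) ×ˢ
    (Finset.Icc 1 V) ×ˢ (Finset.Icc 1 Y) ×ˢ (Finset.Icc 1 Y)).filter
      (fun a => a.1 * a.2.2.1 ≤ V) with hI
  have haI : ∀ x ∈ B, a x ∈ I := by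
    intro x hx
    have h1 : (a x).1 ≤ V := (Nat.le_mul_of_pos_right _ (hw x hx)).trans (hgw x hx)
    have h2 : (a x).2.1 ≤ V := (Nat.le_mul_of_pos_left _ (hg x hx)).trans (hgw x hx)
    have h3 : (a x).2.2.1 ≤ V := (Nat.le_mul_of_pos_left _ (hg x hx)).trans (hgw' x hx)
    simp only [hI, Finset.mem_filter, Finset.mem_product, Finset.mem_Icc]
    exact ⟨⟨⟨hg x hx, h1⟩, ⟨hw x hx, h2⟩, ⟨hw' x hx, h3⟩, ⟨hq0 x hx, hqY x hx⟩,
      ⟨hq0' x hx, hqY' x hx⟩⟩, hgw' x hx⟩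
  have hinner : ∀ α ∈ I, ∀ β : ℤ,
      ((B.filter (fun x => a x = α ∧ b x = β)).card : ℝ) ≤ T ^ 2 * (5 * Y / α.2.1) := by
    intro α hα β
    set F := B.filter (fun x => a x = α ∧ b x = β) with hF
    simp only [hI, Finset.mem_filter, Finset.mem_product, Finset.mem_Icc] at hα
    obtain ⟨⟨-, ⟨hw1, hwV⟩, -⟩, -⟩ := hα
    set w := α.2.1 with hwdef
    set m := w / Nat.gcd w 4 with hm
    have hdm : Nat.gcd w 4 * m = w := Nat.mul_div_cancel' (Nat.gcd_dvd_left w 4)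
    have hm0 : m ≠ 0 := by
      intro h0
      rw [h0, mul_zero] at hdm
      omega
    have hmw : m ∣ w := ⟨_, by rw [mul_comm]; exact hdm.symm⟩
    have hwm : w ≤ 4 * m := by
      calc w = Nat.gcd w 4 * m := hdm.symm
        _ ≤ 4 * m := by
          gcongr
          exact Nat.le_of_dvd (by norm_num) (Nat.gcd_dvd_right w 4)
    have hinj : Set.InjOn (fun x : ℕ × ℕ => x.2) (F : Set (ℕ × ℕ)) := by
      intro x hx y hy hxy
      simp only [hF, Finset.coe_filter, Set.mem_ofPred_eq] at hx hy
      obtain ⟨hxB, hxa, hxb⟩ := hx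
      obtain ⟨hyB, hya, hyb⟩ := hy
      have hxy' : x.2 = y.2 := hxy
      have hll : l x = l y := by
        have h1 := hbl x hxB
        have h2 := hbl y hyB
        rw [hxa, hxb] at h1
        rw [hya, hyb] at h2
        have h3 : β ≠ 0 := by
          have := left_ne_zero_of_mul (hbl0 x hxB)
          rwa [hxb] at this
        exact mul_left_cancel₀ h3 (h1.trans h2.symm)
      have huu : u' x = u' y := by
        have h1 := hlin x hxB
        have h2 := hlin y hyB
        rw [hxa, hxb, hll, hxy'] at h1
        rw [hya, hyb] at h2
        have h3 : (α.2.1 : ℤ) ≠ 0 := by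
          rw [← hwdef]
          positivity
        have := mul_right_cancel₀ h3 (h1.trans h2.symm)
        linarith
      have hdd : x.1 = y.1 := by
        have h1 := hrep x hxB
        have h2 := hrep y hyB
        have h4 := hg x hxB
        have h5 := hw' x hxB
        rw [hxa] at h1 h4 h5
        rw [hxy', huu] at h1
        rw [hya] at h2
        have h3 : (((α.1 * α.2.2.1 : ℕ) : ℤ) ^ 2) ≠ 0 := by positivity
        have h6 : (x.1 : ℤ) * ((α.1 * α.2.2.1 : ℕ) : ℤ) ^ 2
            = y.1 * ((α.1 * α.2.2.1 : ℕ) : ℤ) ^ 2 := by linarith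
        exact_mod_cast mul_right_cancel₀ h3 h6
      exact Prod.ext hdd hxy'
    have h1 := card_filter_cube_congr_le m Y hm0 (F.image (fun x => x.2)) ?_ ?_
    · rw [Finset.card_image_of_injOn hinj] at h1
      have hwR : (0 : ℝ) < w := by exact_mod_cast hw1
      have hmR : (0 : ℝ) < m := by exact_mod_cast Nat.pos_of_ne_zero hm0
      have hmV : m ≤ V := (Nat.le_of_dvd hw1 hmw).trans hwV
      have h2 : ((Y / m : ℕ) : ℝ) + 1 ≤ 5 * Y / w := by
        have h3 : ((Y / m : ℕ) : ℝ) ≤ Y / m := Nat.cast_div_le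
        have h4 : (Y : ℝ) / m ≤ 4 * Y / w := by
          rw [div_le_div_iff₀ hmR hwR]
          have : (w : ℝ) ≤ 4 * m := by exact_mod_cast hwm
          have hY : (0 : ℝ) ≤ Y := Nat.cast_nonneg Y
          nlinarith
        have h5 : (1 : ℝ) ≤ Y / w := by
          rw [le_div_iff₀ hwR, one_mul]
          exact_mod_cast hwV.trans hVY
        calc ((Y / m : ℕ) : ℝ) + 1 ≤ 4 * Y / w + Y / w := by linarith
          _ = 5 * Y / w := by ring
      calc (F.card : ℝ) ≤ (m.divisors.card : ℝ) ^ 2 * (((Y / m : ℕ) : ℝ) + 1) := by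
            exact_mod_cast h1
        _ ≤ T ^ 2 * (5 * Y / w) := by
            gcongr
            exact hT1 m hm0 hmV
    · intro p hp
      obtain ⟨x, hx, rfl⟩ := Finset.mem_image.mp hp
      simp only [hF, Finset.mem_filter] at hx
      refine ⟨hpY x hx.1, ?_⟩
      have := hpw x hx.1
      rw [hx.2.1] at this
      exact this.coprime_dvd_right hmw
    · intro p hp p' hp'
      obtain ⟨x, hx, rfl⟩ := Finset.mem_image.mp hp
      obtain ⟨y, hy, rfl⟩ := Finset.mem_image.mp hp'
      simp only [hF, Finset.mem_filter] at hx hy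
      obtain ⟨hxB, hxa, hxb⟩ := hx
      obtain ⟨hyB, hya, hyb⟩ := hy
      have hll : l x = l y := by
        have h1 := hbl x hxB
        have h2 := hbl y hyB
        rw [hxa, hxb] at h1
        rw [hya, hyb] at h2
        have h3 : β ≠ 0 := by
          have := left_ne_zero_of_mul (hbl0 x hxB)
          rwa [hxb] at this
        exact mul_left_cancel₀ h3 (h1.trans h2.symm)
      have h1 := hlin x hxB
      have h2 := hlin y hyB
      have h3 := hgcd x hxB
      rw [hxa, hxb, hll] at h1
      rw [hya, hyb] at h2
      rw [hxa, hxb] at h3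
      exact dvd_cube_sub_cube hw1 h3 h1 h2
  have hmid : ∀ α ∈ I, ((B.filter (fun x => a x = α)).card : ℝ) ≤ 10 * T ^ 3 * Y * (1 / α.2.1) := by
    intro α hα
    set F := B.filter (fun x => a x = α) with hF
    rcases F.eq_empty_or_nonempty with h0 | ⟨x₀, hx₀⟩
    · rw [h0]
      simp only [Finset.card_empty, Nat.cast_zero]
      have : 0 ≤ T := by
        have hα' := hα
        simp only [hI, Finset.mem_filter, Finset.mem_product, Finset.mem_Icc] at hα'
        exact (Nat.cast_nonneg _).trans (hT1 1 one_ne_zero (hα'.1.1.1.trans hα'.1.1.2))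
      positivity
    set M : ℤ := 4 * ((α.2.2.2.2 : ℤ) ^ 3 * (α.2.1 : ℤ) ^ 2
      - (α.2.2.2.1 : ℤ) ^ 3 * (α.2.2.1 : ℤ) ^ 2) with hM
    have hMx : ∀ x ∈ F, b x * l x = M ∧ M ≠ 0 := by
      intro x hx
      simp only [hF, Finset.mem_filter] at hx
      have h1 : b x * l x = M := by
        have h := hbl x hx.1
        rw [hx.2] at h
        exact h
      exact ⟨h1, h1 ▸ hbl0 x hx.1⟩
    have hM0 : M.natAbs ≠ 0 := Int.natAbs_ne_zero.mpr (hMx x₀ hx₀).2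
    have hMle : M.natAbs ≤ 8 * Y ^ 3 * V ^ 2 := by
      have hα' := hα
      simp only [hI, Finset.mem_filter, Finset.mem_product, Finset.mem_Icc] at hα'
      obtain ⟨⟨-, ⟨-, h1⟩, ⟨-, h2⟩, ⟨-, h3⟩, ⟨-, h4⟩⟩, -⟩ := hα'
      have h5 : α.2.2.2.2 ^ 3 * α.2.1 ^ 2 ≤ Y ^ 3 * V ^ 2 := by gcongr
      have h6 : α.2.2.2.1 ^ 3 * α.2.2.1 ^ 2 ≤ Y ^ 3 * V ^ 2 := by gcongr
      zify at h5 h6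
      have h7 : (0 : ℤ) ≤ (α.2.2.2.2 : ℤ) ^ 3 * (α.2.1 : ℤ) ^ 2 := by positivity
      have h8 : (0 : ℤ) ≤ (α.2.2.2.1 : ℤ) ^ 3 * (α.2.2.1 : ℤ) ^ 2 := by positivity
      zify
      rw [abs_le]
      constructor <;> rw [hM] <;> linarith
    set Δ : Finset ℤ := M.natAbs.divisors.image (fun n : ℕ => (n : ℤ)) ∪
      M.natAbs.divisors.image (fun n : ℕ => -(n : ℤ)) with hΔ
    have hΔcard : (Δ.card : ℝ) ≤ 2 * T := by
      have h1 : Δ.card ≤ M.natAbs.divisors.card + M.natAbs.divisors.card :=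
        (Finset.card_union_le _ _).trans
          (Nat.add_le_add Finset.card_image_le Finset.card_image_le)
      have h2 := hT _ hM0 hMle
      have h3 : (Δ.card : ℝ) ≤ M.natAbs.divisors.card + M.natAbs.divisors.card := by
        exact_mod_cast h1
      linarith
    have hbΔ : ∀ x ∈ F, b x ∈ Δ := by
      intro x hx
      have h1 : (b x).natAbs ∈ M.natAbs.divisors :=
        Nat.mem_divisors.mpr ⟨Int.natAbs_dvd_natAbs.mpr ⟨l x, (hMx x hx).1.symm⟩, hM0⟩
      rw [hΔ, Finset.mem_union, Finset.mem_image, Finset.mem_image]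
      rcases Int.natAbs_eq (b x) with h2 | h2
      · exact Or.inl ⟨_, h1, h2.symm⟩
      · exact Or.inr ⟨_, h1, h2.symm⟩
    rw [Finset.card_eq_sum_card_fiberwise hbΔ]
    push_cast
    calc ∑ β ∈ Δ, ((F.filter (fun x => b x = β)).card : ℝ)
        ≤ ∑ β ∈ Δ, T ^ 2 * (5 * Y / α.2.1) := by
          refine Finset.sum_le_sum fun β _ => ?_
          rw [hF, Finset.filter_filter]
          exact hinner α hα β
      _ = Δ.card * (T ^ 2 * (5 * Y / α.2.1)) := by simp
      _ ≤ (2 * T) * (T ^ 2 * (5 * Y / α.2.1)) := by gcongr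
      _ = _ := by ring
  rw [Finset.card_eq_sum_card_fiberwise haI]
  push_cast
  have hT3 : 0 ≤ T ^ 3 ∨ V = 0 := by
    rcases Nat.eq_zero_or_pos V with h | h
    · exact Or.inr h
    · exact Or.inl (pow_nonneg ((Nat.cast_nonneg _).trans (hT1 1 one_ne_zero h)) 3)
  rcases hT3 with hT3 | hV0
  swap
  · subst hV0
    simp [hI]
  calc ∑ α ∈ I, ((B.filter (fun x => a x = α)).card : ℝ)
      ≤ ∑ α ∈ I, 10 * T ^ 3 * Y * (1 / (α.2.1 : ℝ)) := Finset.sum_le_sum hmid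
    _ = 10 * T ^ 3 * Y * ∑ g ∈ Finset.Icc 1 V, ∑ w ∈ Finset.Icc 1 V, ∑ w' ∈ Finset.Icc 1 V,
          ∑ q ∈ Finset.Icc 1 Y, ∑ q' ∈ Finset.Icc 1 Y,
            (if g * w' ≤ V then 1 / (w : ℝ) else 0) := by
        rw [← Finset.mul_sum, hI, Finset.sum_filter]
        simp only [Finset.sum_product]
    _ ≤ 10 * T ^ 3 * Y * ∑ g ∈ Finset.Icc 1 V, ∑ w ∈ Finset.Icc 1 V,
          (V / g : ℝ) * ((Y : ℝ) ^ 2 * (1 / (w : ℝ))) := by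
        gcongr with g hg w hw
        simp only [Finset.sum_const, Nat.card_Icc, Nat.add_sub_cancel, nsmul_eq_mul]
        have h1 : ∑ w' ∈ Finset.Icc 1 V, (Y : ℝ) * (Y * (if g * w' ≤ V then 1 / (w : ℝ) else 0))
            = ((Finset.Icc 1 V).filter (fun w' => g * w' ≤ V)).card
              * ((Y : ℝ) ^ 2 * (1 / (w : ℝ))) := by
          rw [← nsmul_eq_mul, ← Finset.sum_const, Finset.sum_filter]
          refine Finset.sum_congr rfl fun w' _ => ?_
          split_ifs
          · ring
          · ring
        rw [h1]
        gcongr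
        have hg1 : 1 ≤ g := (Finset.mem_Icc.mp hg).1
        have h2 : (Finset.Icc 1 V).filter (fun w' => g * w' ≤ V) ⊆ Finset.Icc 1 (V / g) := by
          intro w' hw'
          simp only [Finset.mem_filter, Finset.mem_Icc] at hw' ⊢
          refine ⟨hw'.1.1, ?_⟩
          rw [Nat.le_div_iff_mul_le hg1, mul_comm]
          exact hw'.2
        calc (((Finset.Icc 1 V).filter (fun w' => g * w' ≤ V)).card : ℝ)
            ≤ ((Finset.Icc 1 (V / g)).card : ℝ) := by exact_mod_cast Finset.card_le_card h2
          _ = ((V / g : ℕ) : ℝ) := by simp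
          _ ≤ _ := Nat.cast_div_le
    _ = _ := by
        rw [sq (∑ n ∈ Finset.Icc 1 V, (1 : ℝ) / n), Finset.sum_mul_sum]
        simp only [Finset.mul_sum]
        refine Finset.sum_congr rfl fun g _ => Finset.sum_congr rfl fun w _ => ?_
        ring

open scoped nonZeroDivisors

theorem four_mul_prime_cube_ne_sq {p q : ℕ} (hp : p.Prime) (hq : q.Prime) (hpq : p ≠ q) (n : ℕ) :
    4 * (p ^ 3 * q ^ 3) ≠ n ^ 2 := by
  intro h
  have h1 : 2 ^ 2 * (p ^ 3 * q ^ 3) = n ^ 2 := h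
  have h2 := congrArg (fun n => n.factorization p) h1
  have hp0 := hp.ne_zero
  have hq0 := hq.ne_zero
  simp only [Nat.factorization_mul, Nat.factorization_pow, hp0, hq0, ne_eq, pow_eq_zero_iff,
    not_false_eq_true, OfNat.ofNat_ne_zero, mul_eq_zero, or_self, Finsupp.coe_add,
    Finsupp.coe_smul, Pi.add_apply, Pi.smul_apply, hp.factorization_self, smul_eq_mul,
    hq.factorization, Finsupp.single_apply, hpq.symm, if_false] at h2
  omega

/-- A commutative ring behaving like the maximal order of `ℚ(√-d)`: it contains a square root
`δ` of `-d` and has a conjugation `σ` with integer norms such that all elements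
lie in `½(ℤ + ℤδ)`. -/
structure ImagQuadraticOrder (R : Type*) [CommRing R] (d : ℕ) where
  δ : R
  σ : R →+* R
  pos : 0 < d
  δ_sq : δ ^ 2 = -(d : R)
  σ_δ : σ δ = -δ
  half : ∀ x : R, ∃ u v : ℤ, 2 * x = u + v * δ
  norm : ∀ x : R, ∃ n : ℤ, x * σ x = n

namespace ImagQuadraticOrder

variable {R : Type*} [CommRing R] {d : ℕ} (A : ImagQuadraticOrder R d)

/-- The norm `x * σ x` as an integer. -/
noncomputable def nrm (x : R) : ℤ := (A.norm x).choose

theorem nrm_spec (x : R) : (A.nrm x : R) = x * A.σ x := (A.norm x).choose_spec.symm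

variable [CharZero R]

theorem sq_add_eq_of_half {x : R} {u v : ℤ} (h : 2 * x = u + v * A.δ) :
    4 * A.nrm x = u ^ 2 + d * v ^ 2 := by
  have h2 : 2 * A.σ x = u - v * A.δ := by
    have := congrArg A.σ h
    simpa only [map_mul, map_add, map_ofNat, map_intCast, A.σ_δ, mul_neg, ← sub_eq_add_neg]
      using this
  have : ((4 * A.nrm x : ℤ) : R) = ((u ^ 2 + d * v ^ 2 : ℤ) : R) := by
    push_cast
    rw [A.nrm_spec]
    linear_combination (2 * A.σ x) * h + (u + v * A.δ) * h2 - (v : R) ^ 2 * A.δ_sq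
  exact_mod_cast this

theorem nrm_int_mul (m : ℤ) (x : R) : A.nrm (m * x) = m ^ 2 * A.nrm x := by
  have : (A.nrm (m * x) : R) = ((m ^ 2 * A.nrm x : ℤ) : R) := by
    push_cast
    rw [A.nrm_spec, A.nrm_spec, map_mul, map_intCast]
    ring
  exact_mod_cast this

theorem nrm_mul (x y : R) : A.nrm (x * y) = A.nrm x * A.nrm y := by
  have : (A.nrm (x * y) : R) = ((A.nrm x * A.nrm y : ℤ) : R) := by
    push_cast
    rw [A.nrm_spec, A.nrm_spec, A.nrm_spec, map_mul]
    ring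
  exact_mod_cast this

theorem nrm_pair (b c : ℤ) : A.nrm (b + c * A.δ) = b ^ 2 + d * c ^ 2 := by
  have h := A.sq_add_eq_of_half (x := b + c * A.δ) (u := 2 * b) (v := 2 * c)
    (by push_cast; ring)
  linarith

theorem span_mul_map_span {p : ℕ} {b : ℤ} (hp : p.Prime) (hp2 : p ≠ 2) (hpd : ¬ p ∣ d)
    (hb : (p : ℤ) ∣ b ^ 2 + d) :
    Ideal.span {(p : R), (b : R) + A.δ} * (Ideal.span {(p : R), (b : R) + A.δ}).map A.σ =
      Ideal.span {(p : R)} := by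
  obtain ⟨k, hk⟩ := hb
  have hk' : (b : R) ^ 2 + d = p * k := by exact_mod_cast congrArg (Int.cast : ℤ → R) hk
  have hmap : (Ideal.span {(p : R), (b : R) + A.δ}).map A.σ =
      Ideal.span {(p : R), (b : R) - A.δ} := by
    rw [Ideal.map_span, Set.image_pair, map_natCast, map_add, map_intCast, A.σ_δ,
      ← sub_eq_add_neg]
  have hcop : IsCoprime (p : ℤ) (2 * b) := by
    have hpz := Nat.prime_iff_prime_int.mp hp
    rw [Prime.coprime_iff_not_dvd hpz]
    intro h
    rcases hpz.dvd_or_dvd h with h | h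
    · have : p ∣ 2 := by exact_mod_cast h
      exact hp2 ((Nat.prime_dvd_prime_iff_eq hp Nat.prime_two).mp this)
    · apply hpd
      have h1 : (p : ℤ) ∣ d := by
        have : (d : ℤ) = p * k - b * b := by linarith
        rw [this]
        exact dvd_sub (dvd_mul_right _ _) (h.mul_left _)
      exact_mod_cast h1
  obtain ⟨x, y, hxy⟩ := hcop
  have hxy' : (x : R) * p + y * (2 * b) = 1 := by exact_mod_cast congrArg (Int.cast : ℤ → R) hxy
  rw [hmap, Ideal.span_pair_mul_span_pair]
  apply le_antisymm
  · rw [Ideal.span_le]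
    rintro z (rfl | rfl | rfl | rfl) <;> rw [SetLike.mem_coe, Ideal.mem_span_singleton]
    · exact dvd_mul_right _ _
    · exact dvd_mul_right _ _
    · exact dvd_mul_left _ _
    · exact ⟨k, by linear_combination hk' - A.δ_sq⟩
  · rw [Ideal.span_singleton_le_iff_mem]
    have h1 : (p : R) = x * (p * p) + y * (p * (b - A.δ)) + y * ((b + A.δ) * p) := by
      linear_combination -(p : R) * hxy'
    have h2 : x * (p * p) + y * (p * (b - A.δ)) + y * ((b + A.δ) * p) ∈
        Ideal.span {(p : R) * p, p * (b - A.δ), (b + A.δ) * p, (b + A.δ) * (b - A.δ)} := by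
      refine Ideal.add_mem _ (Ideal.add_mem _ ?_ ?_) ?_ <;>
        exact Ideal.mul_mem_left _ _ (Ideal.subset_span (by simp))
    rwa [← h1] at h2

theorem int_dvd_of_dvd (A : ImagQuadraticOrder R d) {m n : ℤ} (h : (m : R) ∣ n) : m ∣ n := by
  obtain ⟨x, hx⟩ := h
  rcases eq_or_ne m 0 with rfl | hm
  · have : (n : R) = 0 := by simpa using hx
    have : n = 0 := by exact_mod_cast this
    simp [this]
  have h1 : n ^ 2 = m ^ 2 * A.nrm x := by
    rw [← A.nrm_int_mul, ← hx]
    have := A.nrm_pair n 0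
    simpa using this.symm
  exact (Int.pow_dvd_pow_iff two_ne_zero).mp ⟨_, h1⟩

section IsDomain

variable [IsDomain R]

theorem nrm_pos {x : R} (hx : x ≠ 0) : 0 < A.nrm x := by
  obtain ⟨u, v, h⟩ := A.half x
  have h1 := A.sq_add_eq_of_half h
  have hd : (0 : ℤ) < d := by exact_mod_cast A.pos
  by_contra! h0
  have hv : v = 0 := by
    by_contra hv
    have : 0 < v ^ 2 := by positivity
    nlinarith [sq_nonneg u]
  have hu : u = 0 := by
    by_contra hu
    have : 0 < u ^ 2 := by positivity
    nlinarith [sq_nonneg v]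
  subst hu hv
  simp at h
  exact hx h

/-- Every nonzero ideal is equivalent to `(n, b + δ)` for a reduced pair `(b, n)`. -/
theorem exists_reduced (I : Ideal R) (hI : I ≠ ⊥) :
    ∃ (a : R) (b : ℤ) (n : ℕ), a ≠ 0 ∧ 0 < n ∧ (n : ℤ) ∣ b ^ 2 + d ∧ b ^ 2 ≤ d ∧
      Ideal.span {(n : R)} * I = Ideal.span {a} * Ideal.span {(n : R), (b : R) + A.δ} := by
  classical
  obtain ⟨x₀, hx₀, hx₀0⟩ := Submodule.exists_mem_ne_zero_of_ne_bot hI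
  obtain ⟨a, ⟨haI, ha0⟩, hmin⟩ := exists_minimalFor_of_wellFoundedLT
    (fun x : R => x ∈ I ∧ x ≠ 0) (fun x => (A.nrm x).toNat) ⟨x₀, hx₀, hx₀0⟩
  have hmin' : ∀ x ∈ I, x ≠ 0 → A.nrm a ≤ A.nrm x := by
    intro x hx hx0
    by_contra! h
    have h1 := A.nrm_pos hx0
    have h2 : (A.nrm a).toNat ≤ (A.nrm x).toNat :=
      hmin (j := x) ⟨hx, hx0⟩ (show (A.nrm x).toNat ≤ (A.nrm a).toNat by omega)
    omega
  set N := A.nrm a with hN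
  have hNpos : 0 < N := A.nrm_pos ha0
  have hNR : (N : R) = a * A.σ a := A.nrm_spec a
  have hσa : A.σ a ≠ 0 := by
    intro h
    rw [h, mul_zero] at hNR
    have : N = 0 := by exact_mod_cast hNR
    omega
  -- elements of `I` that are rational multiples of `a`
  have hrat : ∀ x ∈ I, ∀ m r : ℤ, 0 < m → (m : R) * x = r * a → ∃ k : ℤ, x = k * a := by
    intro x hx m r hm h
    refine ⟨r / m, ?_⟩
    by_contra hne
    set y := x - (r / m : ℤ) * a with hy
    have hyI : y ∈ I := I.sub_mem hx (I.mul_mem_left _ haI)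
    have hy0 : y ≠ 0 := sub_ne_zero.mpr hne
    have h1 : (m : R) * y = (r % m : ℤ) * a := by
      have : (r : R) = m * (r / m : ℤ) + (r % m : ℤ) := by
        exact_mod_cast (Int.mul_ediv_add_emod r m).symm
      rw [hy, mul_sub, h, this]
      ring
    have h2 : m ^ 2 * A.nrm y = (r % m) ^ 2 * N := by
      rw [← A.nrm_int_mul, h1, A.nrm_int_mul]
    have h3 := hmin' y hyI hy0
    have h4 := Int.emod_nonneg r hm.ne'
    have h5 := Int.emod_lt_of_pos r hm
    have h6 : (r % m) ^ 2 < m ^ 2 := by nlinarith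
    nlinarith
  -- the subgroup of `δ`-coordinates
  let S : AddSubgroup ℤ :=
    { carrier := {v | ∃ x ∈ I, ∃ u : ℤ, 2 * (x * A.σ a) = u + v * A.δ}
      zero_mem' := ⟨0, I.zero_mem, 0, by simp⟩
      add_mem' := by
        rintro v w ⟨x, hx, u, h⟩ ⟨y, hy, u', h'⟩
        exact ⟨x + y, I.add_mem hx hy, u + u', by push_cast; linear_combination h + h'⟩
      neg_mem' := by
        rintro v ⟨x, hx, u, h⟩
        exact ⟨-x, I.neg_mem hx, -u, by push_cast; linear_combination -h⟩ }
  obtain ⟨v₀, hv₀⟩ := Int.subgroup_cyclic S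
  have hS : ∀ v, v ∈ S ↔ ∃ k : ℤ, k * v₀ = v := by
    intro v
    rw [hv₀, AddSubgroup.mem_closure_singleton]
    simp
  obtain ⟨y₀, hy₀, u₀, h₀⟩ : v₀ ∈ S := (hS v₀).mpr ⟨1, by simp⟩
  have hgen₀ : ∀ y ∈ I, ∃ m k : ℤ, y = m * a + k * y₀ := by
    intro y hy
    obtain ⟨u, v, huv⟩ := A.half (y * A.σ a)
    obtain ⟨k, rfl⟩ := (hS v).mp ⟨y, hy, u, huv⟩
    obtain ⟨m, hm⟩ := hrat (y - k * y₀) (I.sub_mem hy (I.mul_mem_left _ hy₀)) (2 * N)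
      (u - k * u₀) (by omega) (by
        push_cast at huv ⊢
        rw [hNR]
        linear_combination a * huv - a * k * h₀)
    exact ⟨m, k, by linear_combination hm⟩
  obtain ⟨k₀, hk₀⟩ := (hS (2 * N)).mp ⟨a * A.δ, I.mul_mem_right _ haI, 0, by
    push_cast
    rw [hNR]
    ring⟩
  have hk₀0 : k₀ ≠ 0 := by
    rintro rfl
    omega
  obtain ⟨b₀, hb₀⟩ := hrat (k₀ * y₀ - A.δ * a)
    (I.sub_mem (I.mul_mem_left _ hy₀) (I.mul_mem_left _ haI)) (2 * N) (k₀ * u₀) (by omega) (by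
      have hk' : (k₀ : R) * v₀ = 2 * (a * A.σ a) := by
        rw [← hNR]
        exact_mod_cast hk₀
      push_cast
      rw [hNR]
      linear_combination a * k₀ * h₀ + a * A.δ * hk')
  obtain ⟨n, y₁, hn, hy₁, hny₁, hgen₁⟩ : ∃ (n : ℕ) (y : R), 0 < n ∧ y ∈ I ∧
      (n : R) * y = (b₀ + A.δ) * a ∧ ∀ z ∈ I, ∃ m k : ℤ, z = m * a + k * y := by
    rcases Int.natAbs_eq k₀ with h | h
    · refine ⟨k₀.natAbs, y₀, Int.natAbs_pos.mpr hk₀0, hy₀, ?_, hgen₀⟩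
      have : ((k₀.natAbs : ℤ) : R) = k₀ := by rw [← h]
      rw [Int.cast_natCast] at this
      rw [this]
      linear_combination hb₀
    · refine ⟨k₀.natAbs, -y₀, Int.natAbs_pos.mpr hk₀0, I.neg_mem hy₀, ?_, fun z hz => ?_⟩
      · have : ((k₀.natAbs : ℤ) : R) = -k₀ := by
          rw [← Int.cast_neg]
          congr 1
          omega
        rw [Int.cast_natCast] at this
        rw [this]
        linear_combination hb₀
      · obtain ⟨m, k, h⟩ := hgen₀ z hz
        exact ⟨m, -k, by push_cast; linear_combination h⟩
  obtain ⟨t, ht⟩ : ∃ t : ℤ, (2 * (b₀ - n * t)) ^ 2 ≤ (n : ℤ) ^ 2 := by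
    have hn' : (0 : ℤ) < n := by exact_mod_cast hn
    refine ⟨(b₀ + n / 2) / n, ?_⟩
    have h1 := Int.mul_ediv_add_emod (b₀ + n / 2) n
    have h2 := Int.emod_nonneg (b₀ + n / 2) hn'.ne'
    have h3 := Int.emod_lt_of_pos (b₀ + n / 2) hn'
    apply sq_le_sq'
    · omega
    · omega
  set b := b₀ - n * t with hb
  set y := y₁ - t * a with hy
  have hyI : y ∈ I := I.sub_mem hy₁ (I.mul_mem_left _ haI)
  have hny : (n : R) * y = (b + A.δ) * a := by
    rw [hy, hb]
    push_cast
    linear_combination hny₁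
  have hgen : ∀ z ∈ I, ∃ m k : ℤ, z = m * a + k * y := by
    intro z hz
    obtain ⟨m, k, h⟩ := hgen₁ z hz
    exact ⟨m + k * t, k, by rw [hy]; push_cast; linear_combination h⟩
  have hd : (0 : ℤ) < d := by exact_mod_cast A.pos
  have hnrm : (n : ℤ) ^ 2 * A.nrm y = (b ^ 2 + d) * N := by
    have h1 := A.nrm_int_mul n y
    rw [Int.cast_natCast, hny, A.nrm_mul] at h1
    have h2 := A.nrm_pair b 1
    simp only [Int.cast_one, one_mul, one_pow, mul_one] at h2
    rw [← h1, h2]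
  have hy0 : y ≠ 0 := by
    intro h
    have h3 : A.nrm (0 : R) = 0 := by
      have := A.nrm_int_mul 0 (0 : R)
      simpa using this
    rw [h, h3, mul_zero] at hnrm
    have : 0 < (b ^ 2 + d) * N := by positivity
    omega
  have hle : (n : ℤ) ^ 2 ≤ b ^ 2 + d := by
    have h1 := hmin' y hyI hy0
    have h2 : (n : ℤ) ^ 2 * N ≤ (b ^ 2 + d) * N := by
      rw [← hnrm]
      gcongr
    exact le_of_mul_le_mul_right h2 hNpos
  refine ⟨a, b, n, ha0, hn, ?_, by nlinarith, ?_⟩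
  · obtain ⟨k, hk⟩ := hrat ((A.δ - b) * y) (I.mul_mem_left _ hyI) n (-(b ^ 2 + d))
      (by exact_mod_cast hn) (by
        push_cast
        linear_combination (A.δ - b) * hny + a * A.δ_sq)
    have h1 : ((n * k : ℤ) : R) * a = ((-(b ^ 2 + d) : ℤ) : R) * a := by
      push_cast
      linear_combination -(n : R) * hk + (A.δ - b) * hny + a * A.δ_sq
    have h2 := mul_right_cancel₀ ha0 h1
    have h3 : n * k = -(b ^ 2 + (d : ℤ)) := by exact_mod_cast h2
    exact ⟨-k, by linarith⟩
  · apply le_antisymm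
    · rw [Ideal.span_singleton_mul_le_iff]
      intro z hz
      obtain ⟨m, k, h⟩ := hgen z hz
      rw [Ideal.mem_span_singleton_mul]
      refine ⟨m * n + k * (b + A.δ), ?_, by rw [h]; linear_combination -(k : R) * hny⟩
      exact Ideal.mem_span_pair.mpr ⟨m, k, rfl⟩
    · rw [Ideal.span_singleton_mul_le_iff]
      intro z hz
      obtain ⟨r, s, rfl⟩ := Ideal.mem_span_pair.mp hz
      rw [Ideal.mem_span_singleton_mul]
      exact ⟨r * a + s * y, I.add_mem (I.mul_mem_left _ haI) (I.mul_mem_left _ hyI),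
        by linear_combination s * hny⟩

end IsDomain

variable [IsDedekindDomain R]

theorem card_classGroup_le (A : ImagQuadraticOrder R d) [Finite (ClassGroup R)] :
    Nat.card (ClassGroup R) ≤
      ∑ b ∈ Finset.Icc (-(d.sqrt : ℤ)) d.sqrt, (b ^ 2 + d).natAbs.divisors.card := by
  classical
  have hd := A.pos
  let F : Finset (Σ _ : ℤ, ℕ) :=
    (Finset.Icc (-(d.sqrt : ℤ)) d.sqrt).sigma fun b => (b ^ 2 + d).natAbs.divisors
  have key : ∀ c : ClassGroup R, ∃ x ∈ F, x.2 ≠ 0 ∧ ∃ I : (Ideal R)⁰, ClassGroup.mk0 I = c ∧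
      ∃ a : R, a ≠ 0 ∧ Ideal.span {(x.2 : R)} * I =
        Ideal.span {a} * Ideal.span {(x.2 : R), (x.1 : R) + A.δ} := by
    intro c
    obtain ⟨I, rfl⟩ := ClassGroup.mk0_surjective c
    obtain ⟨a, b, n, ha, hn, hdvd, hb, h⟩ := A.exists_reduced I (nonZeroDivisors.coe_ne_zero I)
    refine ⟨⟨b, n⟩, ?_, hn.ne', I, rfl, a, ha, h⟩
    simp only [F, Finset.mem_sigma, Finset.mem_Icc, Nat.mem_divisors]
    have h1 : b.natAbs ≤ d.sqrt := by
      rw [Nat.le_sqrt', ← Int.ofNat_le]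
      push_cast
      rwa [sq_abs]
    refine ⟨by omega, Int.natCast_dvd.mp hdvd, ?_⟩
    rw [Int.natAbs_ne_zero]
    positivity
  choose x hxF hx0 I hI a ha h using key
  have hinj : Function.Injective x := by
    intro c c' hcc
    have hn' : ((x c).2 : R) ≠ 0 := by exact_mod_cast hx0 c
    rw [← hI c, ← hI c']
    refine (ClassGroup.mk0_eq_mk0_iff).mpr ⟨a c' * (x c).2, a c * (x c).2,
      mul_ne_zero (ha c') hn', mul_ne_zero (ha c) hn', ?_⟩
    have h1 := h c
    have h2 := h c'
    rw [← hcc] at h2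
    simp only [← Ideal.span_singleton_mul_span_singleton]
    rw [mul_assoc, h1, mul_assoc, h2]
    ring
  have := Fintype.ofFinite (ClassGroup R)
  rw [Nat.card_eq_fintype_card, ← Finset.card_univ, ← Finset.card_sigma]
  exact Finset.card_le_card_of_injOn x (fun c _ => hxF c) hinj.injOn

/-- If the cubes of primes above `p` and `q` are equivalent then `4 p³ q³` is represented
nontrivially by `u² + d v²`. -/
theorem exists_representation {p q : ℕ} {I J : (Ideal R)⁰} (hp : p.Prime)
    (hq : q.Prime) (hpq : p ≠ q)
    (hI : (I : Ideal R) * (I : Ideal R).map A.σ = Ideal.span {(p : R)})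
    (hJ : (J : Ideal R) * (J : Ideal R).map A.σ = Ideal.span {(q : R)})
    (hσ : ((J : Ideal R).map A.σ).map A.σ = J)
    (h : ClassGroup.mk0 I ^ 3 = ClassGroup.mk0 J ^ 3) :
    ∃ (u : ℤ) (v : ℕ), 0 < v ∧ 4 * (p : ℤ) ^ 3 * (q : ℤ) ^ 3 = u ^ 2 + d * (v : ℤ) ^ 2 := by
  rw [← map_pow, ← map_pow, ClassGroup.mk0_eq_mk0_iff] at h
  obtain ⟨x, y, hx, hy, h⟩ := h
  simp only [SubmonoidClass.coe_pow] at h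
  have h1 : Ideal.span {x} * ((I : Ideal R) ^ 3 * (J : Ideal R).map A.σ ^ 3) =
      Ideal.span {y * (q : R) ^ 3} := by
    rw [← mul_assoc, h, mul_assoc, ← mul_pow, hJ, Ideal.span_singleton_pow,
      Ideal.span_singleton_mul_span_singleton]
  have hdvd : x ∣ y * (q : R) ^ 3 :=
    Ideal.span_singleton_le_span_singleton.mp (h1.symm.trans_le Ideal.mul_le_left)
  obtain ⟨α, hα⟩ := hdvd
  have hα' : (I : Ideal R) ^ 3 * (J : Ideal R).map A.σ ^ 3 = Ideal.span {α} := by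
    rw [hα, ← Ideal.span_singleton_mul_span_singleton] at h1
    exact (Ideal.span_singleton_mul_right_inj hx).mp h1
  have hσα : (I : Ideal R).map A.σ ^ 3 * (J : Ideal R) ^ 3 = Ideal.span {A.σ α} := by
    have := congrArg (Ideal.map A.σ) hα'
    rwa [Ideal.map_mul, Ideal.map_pow, Ideal.map_pow, hσ, Ideal.map_span,
      Set.image_singleton] at this
  have h2 : Ideal.span {((p ^ 3 * q ^ 3 : ℤ) : R)} = Ideal.span {(A.nrm α : R)} := by
    rw [A.nrm_spec, ← Ideal.span_singleton_mul_span_singleton, ← hα', ← hσα]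
    push_cast
    rw [← Ideal.span_singleton_mul_span_singleton, ← Ideal.span_singleton_pow,
      ← Ideal.span_singleton_pow, ← hI, ← hJ]
    ring
  have h3 : A.nrm α = p ^ 3 * q ^ 3 := by
    have hα0 : α ≠ 0 := by
      rintro rfl
      rw [mul_zero] at hα
      exact mul_ne_zero hy (pow_ne_zero 3 (by exact_mod_cast hq.ne_zero)) hα
    have h4 := A.nrm_pos hα0
    apply Int.dvd_antisymm h4.le (by positivity)
    · exact A.int_dvd_of_dvd (Ideal.span_singleton_le_span_singleton.mp h2.le)
    · exact A.int_dvd_of_dvd (Ideal.span_singleton_le_span_singleton.mp h2.ge)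
  obtain ⟨u, v, huv⟩ := A.half α
  have h4 := A.sq_add_eq_of_half huv
  rw [h3] at h4
  refine ⟨u, v.natAbs, ?_, by rw [Int.natCast_natAbs, sq_abs, ← h4]; ring⟩
  rw [Int.natAbs_pos]
  rintro rfl
  have h5 : 4 * (p ^ 3 * q ^ 3) = u.natAbs ^ 2 := by
    zify
    rw [sq_abs, h4]
    ring
  exact four_mul_prime_cube_ne_sq hp hq hpq _ h5

end ImagQuadraticOrder

section Kneg

open NumberField

/-- The generator `√d · i` of `Kneg d`. -/
noncomputable def knegGen (d : ℕ) : Kneg d :=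
  ⟨(Real.sqrt d : ℂ) * Complex.I, IntermediateField.mem_adjoin_simple_self ℚ _⟩

theorem knegGen_sq (d : ℕ) : knegGen d ^ 2 = -(d : Kneg d) := by
  apply Subtype.ext
  push_cast
  simp only [knegGen, mul_pow, Complex.I_sq]
  rw [← Complex.ofReal_pow, Real.sq_sqrt (Nat.cast_nonneg d)]
  simp

theorem isIntegral_knegGen (d : ℕ) : IsIntegral ℤ (knegGen d) := by
  refine IsIntegral.of_pow two_pos ?_
  rw [knegGen_sq]
  exact (isIntegral_natCast (R := ℤ) d).neg

instance (d : ℕ) : NumberField (Kneg d) where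
  to_finiteDimensional :=
    IntermediateField.adjoin.finiteDimensional (by
      have h := (isIntegral_knegGen d).tower_top (A := ℚ)
      exact h.map (Kneg d).val)

theorem exists_eq_add_mul_knegGen {d : ℕ} (hd : 0 < d) (x : Kneg d) :
    ∃ r s : ℚ, x = r + s * knegGen d := by
  have key : ∀ z ∈ Kneg d, ∃ r s : ℚ, z = r + s * ((Real.sqrt d : ℂ) * Complex.I) := by
    have hsq : ((Real.sqrt d : ℂ) * Complex.I) ^ 2 = -(d : ℂ) := by
      simpa [knegGen] using congrArg Subtype.val (knegGen_sq d)
    intro z hz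
    induction hz using IntermediateField.adjoin_induction with
    | mem x hx => exact ⟨0, 1, by rw [Set.mem_singleton_iff.mp hx]; simp⟩
    | algebraMap x => exact ⟨x, 0, by simp⟩
    | add x y _ _ hx hy =>
      obtain ⟨r, s, rfl⟩ := hx
      obtain ⟨r', s', rfl⟩ := hy
      exact ⟨r + r', s + s', by push_cast; ring⟩
    | mul x y _ _ hx hy =>
      obtain ⟨r, s, rfl⟩ := hx
      obtain ⟨r', s', rfl⟩ := hy
      exact ⟨r * r' - d * s * s', r * s' + s * r', by
        push_cast
        linear_combination (s : ℂ) * s' * hsq⟩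
    | inv x _ hx =>
      obtain ⟨r, s, rfl⟩ := hx
      rcases eq_or_ne (r ^ 2 + d * s ^ 2) 0 with h0 | h0
      · have hd' : (0 : ℚ) < d := by exact_mod_cast hd
        have hs : s = 0 := by
          by_contra hs
          have : 0 < s ^ 2 := by positivity
          nlinarith [sq_nonneg r]
        have hr : r = 0 := by simpa [hs] using h0
        exact ⟨0, 0, by simp [hs, hr]⟩
      · refine ⟨r / (r ^ 2 + d * s ^ 2), -s / (r ^ 2 + d * s ^ 2), ?_⟩
        have h1 : (r : ℂ) ^ 2 + d * s ^ 2 ≠ 0 := by exact_mod_cast h0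
        symm
        apply eq_inv_of_mul_eq_one_right
        push_cast
        rw [div_mul_eq_mul_div, ← add_div, mul_div_assoc', div_eq_one_iff_eq h1]
        linear_combination -(s : ℂ) ^ 2 * hsq
  obtain ⟨r, s, h⟩ := key x x.2
  exact ⟨r, s, Subtype.ext (by rw [h]; push_cast; rfl)⟩

theorem star_mem_kneg {d : ℕ} (hd : 0 < d) (x : Kneg d) : (starRingEnd ℂ) x ∈ Kneg d := by
  obtain ⟨r, s, rfl⟩ := exists_eq_add_mul_knegGen hd x
  have h : (starRingEnd ℂ) ((r + s * knegGen d : Kneg d) : ℂ) =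
      ((r - s * knegGen d : Kneg d) : ℂ) := by
    push_cast
    simp [knegGen, sub_eq_add_neg]
  rw [h]
  exact Subtype.coe_prop _

/-- Complex conjugation on `Kneg d`. -/
noncomputable def knegConj {d : ℕ} (hd : 0 < d) : Kneg d →+* Kneg d :=
  ((starRingEnd ℂ).comp (algebraMap (Kneg d) ℂ)).codRestrict (Kneg d) (star_mem_kneg hd)

theorem knegConj_knegGen {d : ℕ} (hd : 0 < d) : knegConj hd (knegGen d) = -knegGen d := by
  apply Subtype.ext
  change (starRingEnd ℂ) ((Real.sqrt d : ℂ) * Complex.I) = -((Real.sqrt d : ℂ) * Complex.I)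
  simp

theorem exists_int_of_isIntegral_ratCast {K : Type*} [Field K] [CharZero K] {r : ℚ}
    (h : IsIntegral ℤ (r : K)) : ∃ n : ℤ, r = n := by
  have h1 : IsIntegral ℤ (algebraMap ℚ K r) := by simpa using h
  rw [isIntegral_algebraMap_iff (algebraMap ℚ K).injective] at h1
  obtain ⟨n, hn⟩ := IsIntegrallyClosed.isIntegral_iff.mp h1
  exact ⟨n, by simpa using hn.symm⟩

theorem exists_int_of_sq_mul_squarefree {d : ℕ} (hd : Squarefree d) {t : ℚ} {m : ℤ}
    (h : t ^ 2 * d = m) : ∃ n : ℤ, t = n := by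
  have h1 : (t.num : ℚ) ^ 2 * d = m * t.den ^ 2 := by
    have h2 : (t.den : ℚ) ≠ 0 := by exact_mod_cast t.den_ne_zero
    rw [← h]
    nth_rw 2 [← Rat.num_div_den t]
    field_simp
  have h2 : t.num ^ 2 * d = m * t.den ^ 2 := by exact_mod_cast h1
  have h3 : t.num.natAbs ^ 2 * d = m.natAbs * t.den ^ 2 := by
    have := congrArg Int.natAbs h2
    simpa [Int.natAbs_mul, Int.natAbs_pow] using this
  have h4 : t.den ^ 2 ∣ d :=
    (t.reduced.symm.pow 2 2).dvd_of_dvd_mul_left (h3 ▸ dvd_mul_left _ _)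
  have h5 : t.den = 1 := Nat.isUnit_iff.mp (hd _ (by rwa [← sq]))
  exact ⟨t.num, by conv_lhs => rw [← Rat.num_div_den t, h5]; simp⟩

theorem exists_coords_of_isIntegral {d : ℕ} (hd : Squarefree d) {x : Kneg d}
    (hx : IsIntegral ℤ x) : ∃ u v n : ℤ, 2 * x = u + v * knegGen d ∧
      x * knegConj (Nat.pos_of_ne_zero hd.ne_zero) x = n := by
  have hpos := Nat.pos_of_ne_zero hd.ne_zero
  obtain ⟨r, s, hrs⟩ := exists_eq_add_mul_knegGen hpos x
  have hx' : IsIntegral ℤ (knegConj hpos x) := hx.map (knegConj hpos).toIntAlgHom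
  have hconj : knegConj hpos x = r - s * knegGen d := by
    rw [hrs, map_add, map_mul, map_ratCast, map_ratCast, knegConj_knegGen hpos]
    ring
  have hδ := knegGen_sq d
  obtain ⟨u, hu⟩ := exists_int_of_isIntegral_ratCast (K := Kneg d) (r := 2 * r) (by
    have h := hx.add hx'
    rw [hconj, hrs] at h
    rwa [show ((2 * r : ℚ) : Kneg d) = r + s * knegGen d + (r - s * knegGen d) by
      push_cast
      ring])
  obtain ⟨n, hn⟩ := exists_int_of_isIntegral_ratCast (K := Kneg d) (r := r ^ 2 + d * s ^ 2) (by
    have h := hx.mul hx'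
    rw [hconj, hrs] at h
    rwa [show ((r ^ 2 + d * s ^ 2 : ℚ) : Kneg d) =
        (r + s * knegGen d) * (r - s * knegGen d) by
      push_cast
      linear_combination (s : Kneg d) ^ 2 * hδ])
  obtain ⟨v, hv⟩ := exists_int_of_sq_mul_squarefree hd (t := 2 * s) (m := 4 * n - u ^ 2) (by
    push_cast
    rw [← hn, ← hu]
    ring)
  have hu' : 2 * (r : Kneg d) = u := by exact_mod_cast congrArg (Rat.cast : ℚ → Kneg d) hu
  have hv' : 2 * (s : Kneg d) = v := by exact_mod_cast congrArg (Rat.cast : ℚ → Kneg d) hv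
  have hn' : (r : Kneg d) ^ 2 + d * s ^ 2 = n := by
    exact_mod_cast congrArg (Rat.cast : ℚ → Kneg d) hn
  refine ⟨u, v, n, ?_, ?_⟩
  · rw [hrs, ← hu', ← hv']
    ring
  · rw [hconj, hrs, ← hn']
    linear_combination -(s : Kneg d) ^ 2 * hδ

/-- The ring of integers of `Kneg d` with its conjugation. -/
noncomputable def knegOrder {d : ℕ} (hd : Squarefree d) :
    ImagQuadraticOrder (𝓞 (Kneg d)) d where
  δ := ⟨knegGen d, isIntegral_knegGen d⟩
  σ := RingOfIntegers.mapRingHom (knegConj (Nat.pos_of_ne_zero hd.ne_zero))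
  pos := Nat.pos_of_ne_zero hd.ne_zero
  δ_sq := by
    apply RingOfIntegers.ext
    push_cast
    exact knegGen_sq d
  σ_δ := by
    apply RingOfIntegers.ext
    exact knegConj_knegGen (Nat.pos_of_ne_zero hd.ne_zero)
  half x := by
    obtain ⟨u, v, n, h, -⟩ := exists_coords_of_isIntegral hd x.isIntegral_coe
    refine ⟨u, v, ?_⟩
    apply RingOfIntegers.ext
    push_cast
    exact h
  norm x := by
    obtain ⟨u, v, n, -, h⟩ := exists_coords_of_isIntegral hd x.isIntegral_coe
    refine ⟨n, ?_⟩
    apply RingOfIntegers.ext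
    push_cast
    exact h

open scoped NumberTheorySymbols nonZeroDivisors in
/-- Odd split primes can be labelled by cubes of ideal classes; there are at most `h / h₃` labels,
and equal labels give representations by `u² + d v²`. -/
theorem exists_cube_class_label {d : ℕ} (hd : Squarefree d) :
    ∃ (k : ℕ) (f : ℕ → ℕ), k * hneg 3 d ≤
        ∑ b ∈ Finset.Icc (-(d.sqrt : ℤ)) d.sqrt, (b ^ 2 + d).natAbs.divisors.card ∧
      (∀ p, f p < k) ∧
      ∀ p q : ℕ, p.Prime → q.Prime → p ≠ 2 → q ≠ 2 → p ≠ q → J(-(d : ℤ) | p) = 1 →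
        J(-(d : ℤ) | q) = 1 → f p = f q →
        ∃ (u : ℤ) (v : ℕ), 0 < v ∧
          4 * (p : ℤ) ^ 3 * (q : ℤ) ^ 3 = u ^ 2 + d * (v : ℤ) ^ 2 := by
  classical
  let A := knegOrder hd
  let φ : ClassGroup (𝓞 (Kneg d)) →* ClassGroup (𝓞 (Kneg d)) := powMonoidHom 3
  have hker : hneg 3 d = Nat.card φ.ker := rfl
  have hfin : Finite φ.range := inferInstance
  have hideal : ∀ p : ℕ, ∃ I : (Ideal (𝓞 (Kneg d)))⁰, p.Prime → p ≠ 2 → J(-(d : ℤ) | p) = 1 →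
      (I : Ideal (𝓞 (Kneg d))) * (I : Ideal (𝓞 (Kneg d))).map A.σ = Ideal.span {(p : 𝓞 (Kneg d))} ∧
      ((I : Ideal (𝓞 (Kneg d))).map A.σ).map A.σ = I := by
    intro p
    by_cases hp : p.Prime ∧ p ≠ 2 ∧ J(-(d : ℤ) | p) = 1
    swap
    · exact ⟨1, fun h1 h2 h3 => absurd ⟨h1, h2, h3⟩ hp⟩
    obtain ⟨hp, hp2, hJ⟩ := hp
    have := Fact.mk hp
    rw [← jacobiSym.legendreSym.to_jacobiSym] at hJ
    have h0 : ((-(d : ℤ) : ℤ) : ZMod p) ≠ 0 := by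
      intro h0
      rw [(legendreSym.eq_zero_iff p _).mpr h0] at hJ
      exact zero_ne_one hJ
    obtain ⟨c, hc⟩ := (legendreSym.eq_one_iff p h0).mp hJ
    obtain ⟨b, rfl⟩ := ZMod.intCast_surjective c
    have hb : (p : ℤ) ∣ b ^ 2 + d := by
      rw [← ZMod.intCast_zmod_eq_zero_iff_dvd]
      push_cast at hc ⊢
      linear_combination -hc
    have hpd : ¬ p ∣ d := by
      intro h
      apply h0
      push_cast
      rw [neg_eq_zero, ZMod.natCast_eq_zero_iff]
      exact h
    have hp0 : (p : 𝓞 (Kneg d)) ≠ 0 := by exact_mod_cast hp.ne_zero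
    have hI0 : Ideal.span {(p : 𝓞 (Kneg d)), (b : 𝓞 (Kneg d)) + A.δ} ∈ (Ideal (𝓞 (Kneg d)))⁰ := by
      rw [mem_nonZeroDivisors_iff_ne_zero]
      intro h
      have h1 : (p : 𝓞 (Kneg d)) ∈ Ideal.span {(p : 𝓞 (Kneg d)), (b : 𝓞 (Kneg d)) + A.δ} :=
        Ideal.subset_span (by simp)
      rw [h] at h1
      exact hp0 h1
    refine ⟨⟨_, hI0⟩, fun _ _ _ => ⟨A.span_mul_map_span hp hp2 hpd hb, ?_⟩⟩
    simp only [Ideal.map_span, Set.image_pair, map_natCast, map_add, map_intCast, A.σ_δ, map_neg,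
      neg_neg]
  choose I hI using hideal
  refine ⟨Nat.card φ.range, fun p => (Finite.equivFin φ.range ⟨φ (ClassGroup.mk0 (I p)), _, rfl⟩),
    ?_, fun p => Fin.is_lt _, ?_⟩
  · have h1 : Nat.card φ.range * hneg 3 d = Nat.card (ClassGroup (𝓞 (Kneg d))) := by
      rw [hker, ← Subgroup.card_mul_index φ.ker, Subgroup.index_ker, mul_comm]
    rw [h1]
    exact A.card_classGroup_le
  · intro p q hp hq hp2 hq2 hpq hJp hJq hf
    have h1 := (Finite.equivFin φ.range).injective (Fin.val_injective hf)
    have h2 : ClassGroup.mk0 (I p) ^ 3 = ClassGroup.mk0 (I q) ^ 3 := congrArg Subtype.val h1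
    exact A.exists_representation hp hq hpq (hI p hp hp2 hJp).1 (hI q hq hq2 hJq).1
      (hI q hq hq2 hJq).2 h2

end Kneg

theorem card_sub_two_mul_le_card_filter (S : Finset ℕ) (f : ℕ → ℕ) (k : ℕ)
    (hf : ∀ p ∈ S, f p < k) :
    S.card ≤ (S.filter fun p => ∃ q ∈ S, ∃ q' ∈ S, q ≠ p ∧ q' ≠ p ∧ q ≠ q' ∧
      f p = f q ∧ f p = f q').card + 2 * k := by
  classical
  set R : ℕ → Prop := fun p => ∃ q ∈ S, ∃ q' ∈ S, q ≠ p ∧ q' ≠ p ∧ q ≠ q' ∧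
      f p = f q ∧ f p = f q' with hR
  rw [← Finset.card_filter_add_card_filter_not (s := S) R]
  gcongr
  have h := Finset.card_le_mul_card_image_of_maps_to (s := S.filter fun p => ¬ R p)
    (t := Finset.range k) (f := f)
    (fun p hp => Finset.mem_range.mpr (hf p (Finset.mem_filter.mp hp).1)) 2 (by
      intro b _
      by_contra! h
      obtain ⟨p, q, q', hp, hq, hq', hpq, hpq', hqq'⟩ := Finset.two_lt_card_iff.mp h
      simp only [Finset.mem_filter] at hp hq hq'
      exact hp.1.2 ⟨q, hq.1.1, q', hq'.1.1, hpq.symm, hpq'.symm, hqq', by rw [hp.2, hq.2],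
        by rw [hp.2, hq'.2]⟩)
  simpa using h

open scoped NumberTheorySymbols in
theorem card_split_primes_ge (P : Finset ℕ) (hP : ∀ p ∈ P, p.Prime) {d : ℕ} (hd : d ≠ 0) {T : ℝ}
    (hT : (d.divisors.card : ℝ) ≤ T) (hTM : T ≤ P.card / 4)
    (h : |∑ p ∈ P, (J(-(d : ℤ) | p) : ℝ)| < P.card / 4) :
    (P.card : ℝ) / 4 ≤ (P.filter fun p => J(-(d : ℤ) | p) = 1).card := by
  have hpt : ∀ p ∈ P, (1 : ℝ) + J(-(d : ℤ) | p) ≤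
      2 * (if J(-(d : ℤ) | p) = 1 then 1 else 0) + (if p ∣ d then 1 else 0) := by
    intro p hp
    have := Fact.mk (hP p hp)
    rcases jacobiSym.trichotomy (-(d : ℤ)) p with h0 | h1 | h1
    · have : p ∣ d := by
        rw [← jacobiSym.legendreSym.to_jacobiSym, legendreSym.eq_zero_iff] at h0
        push_cast at h0
        rwa [neg_eq_zero, ZMod.natCast_eq_zero_iff] at h0
      simp [h0, this]
    · simp only [h1, if_true]
      split_ifs <;> norm_num
    · simp only [h1]
      split_ifs <;> norm_num
  have hsum := Finset.sum_le_sum hpt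
  rw [Finset.sum_add_distrib, Finset.sum_add_distrib, ← Finset.mul_sum, Finset.sum_boole,
    Finset.sum_boole] at hsum
  have hdiv : ((P.filter fun p => p ∣ d).card : ℝ) ≤ T := by
    refine le_trans ?_ hT
    have : P.filter (fun p => p ∣ d) ⊆ d.divisors := by
      intro p hp
      exact Nat.mem_divisors.mpr ⟨(Finset.mem_filter.mp hp).2, hd⟩
    exact_mod_cast Finset.card_le_card this
  have h2 := (abs_lt.mp h).1
  simp only [Finset.sum_const, nsmul_eq_mul, mul_one] at hsum
  linarith

open scoped NumberTheorySymbols in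
/-- Bound for the number of discriminants with balanced split primes and large 3-torsion. -/
theorem card_balanced_le (P F : Finset ℕ) (Y V : ℕ) (X H T : ℝ) (hX : 1 ≤ X) (hVY : V ≤ Y)
    (hV : 4 * (Y : ℝ) ^ 6 < X * (V + 1) ^ 2)
    (hP : ∀ p ∈ P, p.Prime ∧ p ≠ 2 ∧ V < p ∧ p ≤ Y)
    (hF : ∀ d ∈ F, Squarefree d ∧ X ≤ d ∧ (d : ℝ) < 2 * X ∧ H < hneg 3 d)
    (hbal : ∀ d ∈ F, |∑ p ∈ P, (J(-(d : ℤ) | p) : ℝ)| < P.card / 4)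
    (hT₁ : ∀ n ≠ 0, n ≤ 8 * Y ^ 3 * V ^ 2 → (n.divisors.card : ℝ) ≤ T)
    (hT₂ : ∀ n : ℕ, n ≠ 0 → (n : ℝ) ≤ 4 * X → (n.divisors.card : ℝ) ≤ T)
    (hH : 16 * ((2 * √(2 * X) + 1) * T) ≤ P.card * H) (hH0 : 0 < H) (hTM : T ≤ P.card / 4) :
    (F.card : ℝ) * P.card ≤
      80 * T ^ 3 * (Y : ℝ) ^ 3 * V * (∑ n ∈ Finset.Icc 1 V, (1 : ℝ) / n) ^ 2 := by
  classical
  have key : ∀ d ∈ F, ∃ S ⊆ P, (P.card : ℝ) / 8 ≤ S.card ∧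
      ∀ p ∈ S, ¬ p ∣ d ∧ ∃ q ∈ P, ∃ q' ∈ P, q ≠ q' ∧ (∃ (u : ℤ) (v : ℕ), 0 < v ∧ v ≤ V ∧
        4 * (p : ℤ) ^ 3 * (q : ℤ) ^ 3 = u ^ 2 + d * (v : ℤ) ^ 2) ∧
        (∃ (u : ℤ) (v : ℕ), 0 < v ∧ v ≤ V ∧
        4 * (p : ℤ) ^ 3 * (q' : ℤ) ^ 3 = u ^ 2 + d * (v : ℤ) ^ 2) := by
    intro d hd
    obtain ⟨hsq, hXd, hdX, hHd⟩ := hF d hd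
    have hd0 := hsq.ne_zero
    obtain ⟨k, f, hk, hfk, hrep⟩ := exists_cube_class_label hsq
    have hsplit := card_split_primes_ge P (fun p hp => (hP p hp).1) hd0
      (hT₂ d hd0 (by linarith)) hTM (hbal d hd)
    have hpig := card_sub_two_mul_le_card_filter (P.filter fun p => J(-(d : ℤ) | p) = 1) f k
      (fun p _ => hfk p)
    have hkM : (k : ℝ) ≤ P.card / 16 := by
      have h1 : (k : ℝ) * hneg 3 d ≤ (2 * √(2 * X) + 1) * T := by
        calc (k : ℝ) * hneg 3 d ≤ ∑ b ∈ Finset.Icc (-(d.sqrt : ℤ)) d.sqrt,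
              ((b ^ 2 + d).natAbs.divisors.card : ℝ) := by exact_mod_cast hk
          _ ≤ ∑ b ∈ Finset.Icc (-(d.sqrt : ℤ)) d.sqrt, T := by
              refine Finset.sum_le_sum fun b hb => hT₂ _ ?_ ?_
              · rw [Int.natAbs_ne_zero]
                have : (0 : ℤ) < d := by exact_mod_cast Nat.pos_of_ne_zero hd0
                positivity
              · have h2 : b.natAbs ≤ d.sqrt := by
                  have := Finset.mem_Icc.mp hb
                  omega
                have h3 : b.natAbs ^ 2 ≤ d := Nat.le_sqrt'.mp h2
                have h4 : (b ^ 2 + d).natAbs ≤ d + d := by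
                  refine (Int.natAbs_add_le _ _).trans ?_
                  rw [Int.natAbs_pow, Int.natAbs_natCast]
                  omega
                have h5 : ((b ^ 2 + d).natAbs : ℝ) ≤ d + d := by exact_mod_cast h4
                linarith
          _ = ((2 * d.sqrt + 1 : ℕ) : ℝ) * T := by
              rw [Finset.sum_const, nsmul_eq_mul, Int.card_Icc]
              congr 2
              omega
          _ ≤ _ := by
              have hT0 : 0 ≤ T := (Nat.cast_nonneg _).trans (hT₂ 1 one_ne_zero (by
                push_cast; linarith))
              gcongr
              push_cast
              gcongr
              apply Real.le_sqrt_of_sq_le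
              have : ((d.sqrt ^ 2 : ℕ) : ℝ) ≤ d := by exact_mod_cast Nat.sqrt_le' d
              push_cast at this
              linarith
      have h2 : (k : ℝ) * H ≤ k * hneg 3 d := by gcongr
      have h3 : (k : ℝ) * H ≤ P.card / 16 * H := by linarith
      exact le_of_mul_le_mul_right h3 hH0
    set Q := P.filter fun p => J(-(d : ℤ) | p) = 1 with hQ
    refine ⟨Q.filter fun p => ∃ q ∈ Q, ∃ q' ∈ Q, q ≠ p ∧ q' ≠ p ∧ q ≠ q' ∧ f p = f q ∧
      f p = f q', (Finset.filter_subset _ Q).trans (Finset.filter_subset _ P), ?_, ?_⟩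
    · have h1 := (Nat.cast_le (α := ℝ)).mpr hpig
      push_cast at h1
      linarith
    · have hvV : ∀ p ∈ P, ∀ q ∈ P, ∀ (u : ℤ) (v : ℕ),
          4 * (p : ℤ) ^ 3 * (q : ℤ) ^ 3 = u ^ 2 + d * (v : ℤ) ^ 2 → v ≤ V := by
        intro p hp q hq u v h
        by_contra! hlt
        have h1 : 4 * (p : ℝ) ^ 3 * (q : ℝ) ^ 3 = u ^ 2 + d * (v : ℝ) ^ 2 := by exact_mod_cast h
        have h2 : (p : ℝ) ≤ Y := by exact_mod_cast (hP p hp).2.2.2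
        have h3 : (q : ℝ) ≤ Y := by exact_mod_cast (hP q hq).2.2.2
        have h4 : (V : ℝ) + 1 ≤ v := by exact_mod_cast hlt
        have h5 : 4 * (p : ℝ) ^ 3 * (q : ℝ) ^ 3 ≤ 4 * (Y : ℝ) ^ 3 * (Y : ℝ) ^ 3 := by gcongr
        have h6 : X * ((V : ℝ) + 1) ^ 2 ≤ d * (v : ℝ) ^ 2 := by gcongr
        nlinarith [sq_nonneg (u : ℝ)]
      intro p hp
      simp only [hQ, Finset.mem_filter] at hp
      obtain ⟨⟨hpP, hJp⟩, q, ⟨hqP, hJq⟩, q', ⟨hqP', hJq'⟩, hqp, hqp', hqq, hfq, hfq'⟩ := hp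
      have hpp := hP p hpP
      refine ⟨?_, q, hqP, q', hqP', hqq, ?_, ?_⟩
      · intro hdvd
        have := Fact.mk hpp.1
        rw [← jacobiSym.legendreSym.to_jacobiSym,
          (legendreSym.eq_zero_iff p _).mpr (by
            push_cast
            rw [neg_eq_zero, ZMod.natCast_eq_zero_iff]
            exact hdvd)] at hJp
        exact zero_ne_one hJp
      · obtain ⟨u, v, hv, h⟩ := hrep p q hpp.1 (hP q hqP).1 hpp.2.1 (hP q hqP).2.1 hqp.symm
          hJp hJq hfq
        exact ⟨u, v, hv, hvV p hpP q hqP u v h, h⟩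
      · obtain ⟨u, v, hv, h⟩ := hrep p q' hpp.1 (hP q' hqP').1 hpp.2.1 (hP q' hqP').2.1
          hqp'.symm hJp hJq' hfq'
        exact ⟨u, v, hv, hvV p hpP q' hqP' u v h, h⟩
  choose! S hSP hScard hS using key
  have hcount := card_pairs_two_representations_le Y V hVY T hT₁
    ((F.sigma S).image fun x => (x.1, x.2)) (by
      intro x hx
      obtain ⟨⟨d, p⟩, hdp, rfl⟩ := Finset.mem_image.mp hx
      obtain ⟨hd, hp⟩ := Finset.mem_sigma.mp hdp
      simp only at hd hp
      obtain ⟨hpd, q, hq, q', hq', hqq, ⟨u, v, hv, hvV, h⟩, ⟨u', v', hv', hvV', h'⟩⟩ :=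
        hS d hd p hp
      have h1 := hP p (hSP d hd hp)
      have h2 := hP q hq
      have h3 := hP q' hq'
      exact ⟨q, q', v, v', u, u', h1.1, h2.1, h3.1, h1.2.1, h1.2.2.1, h2.2.2.1, hpd, hqq,
        h1.2.2.2, h2.2.2.2, h3.2.2.2, hv, hvV, hv', hvV', h, h'⟩)
  rw [Finset.card_image_of_injective _ (by
    rintro ⟨a, b⟩ ⟨c, e⟩ h
    simp only [Prod.mk.injEq] at h
    rw [h.1, h.2]), Finset.card_sigma] at hcount
  have hlow : (F.card : ℝ) * (P.card / 8) ≤ ((∑ d ∈ F, (S d).card : ℕ) : ℝ) := by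
    push_cast
    rw [← nsmul_eq_mul]
    exact Finset.card_nsmul_le_sum _ _ _ hScard
  linarith

theorem card_primes_between_ge {W y : ℝ} {V : ℕ} (hW : 100 ≤ W) (hy : W ^ 20 ≤ y)
    (hlog : Real.log (y + 1) ≤ W) (hV : V ≤ 2 * y / W ^ 40) :
    y / W ^ 2 ≤ (((Finset.Icc 3 ⌊y⌋₊).filter fun p => p.Prime ∧ V < p).card : ℝ) := by
  set Y := ⌊y⌋₊ with hY
  set P := (Finset.Icc 3 Y).filter fun p => p.Prime ∧ V < p with hP
  have hW0 : 0 < W := by linarith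
  have hWy : 100 * W ≤ y := by
    calc 100 * W ≤ W * W := by gcongr
      _ = W ^ 2 := by ring
      _ ≤ W ^ 20 := pow_le_pow_right₀ (by linarith) (by norm_num)
      _ ≤ y := hy
  have hy0 : 0 ≤ y := by linarith
  have hYy : (Y : ℝ) ≤ y := Nat.floor_le hy0
  have hyY : y < Y + 1 := Nat.lt_floor_add_one y
  have hcard : Nat.primeCounting Y ≤ P.card + V + 1 := by
    rw [Nat.primeCounting, Nat.primeCounting', Nat.count_eq_card_filter_range]
    have hsub : (Finset.range (Y + 1)).filter Nat.Prime ⊆ P ∪ Finset.Icc 1 V ∪ {2} := by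
      intro p hp
      simp only [hP, Finset.mem_filter, Finset.mem_range, Finset.mem_union, Finset.mem_Icc,
        Finset.mem_singleton] at hp ⊢
      have := hp.2.two_le
      by_cases h : p = 2
      · exact Or.inr h
      · left
        by_cases h' : V < p
        · exact Or.inl ⟨by omega, hp.2, h'⟩
        · exact Or.inr (by omega)
    calc _ ≤ _ := Finset.card_le_card hsub
      _ ≤ (P ∪ Finset.Icc 1 V).card + 1 := Finset.card_union_le _ _
      _ ≤ P.card + (Finset.Icc 1 V).card + 1 := by
          gcongr
          exact Finset.card_union_le _ _
      _ = _ := by simp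
  have hpi := Chebyshev.pi_ge Y
  have hlogY : Real.log Y ≤ W :=
    (Real.log_le_log (by linarith) (by linarith)).trans hlog
  have hlogY0 : 0 < Real.log Y := Real.log_pos (by linarith)
  have hlogY1 : Real.log (Y + 1) ≤ W :=
    (Real.log_le_log (by linarith) (by linarith)).trans hlog
  have h1 : y / 2 ≤ Y * Real.log 2 - Real.log (Y + 1) := by
    have := Real.log_two_gt_d9
    nlinarith
  have h2 : y / 2 / W ≤ Nat.primeCounting Y := by
    refine le_trans ?_ hpi
    gcongr
    linarith
  have h3 : (Nat.primeCounting Y : ℝ) ≤ P.card + V + 1 := by exact_mod_cast hcard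
  have h4 : 2 * y / W ^ 40 ≤ y / W ^ 2 := by
    rw [div_le_div_iff₀ (by positivity) (by positivity)]
    have : W * W ^ 2 ≤ W ^ 40 := by
      rw [← pow_succ']
      exact pow_le_pow_right₀ (by linarith) (by norm_num)
    have h5 : 2 * W ^ 2 ≤ W ^ 40 := by nlinarith [sq_nonneg W]
    nlinarith
  have h5 : (1 : ℝ) ≤ y / W ^ 2 := by
    rw [le_div_iff₀ (by positivity), one_mul]
    exact (pow_le_pow_right₀ (by linarith) (by norm_num)).trans hy
  have h6 : 3 * (y / W ^ 2) ≤ y / 2 / W := by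
    rw [div_div, mul_div_assoc', div_le_div_iff₀ (by positivity) (by positivity)]
    nlinarith [mul_nonneg hy0 hW0.le]
  linarith

open scoped NumberTheorySymbols in
theorem card_biased_le_of_card_large (P E : Finset ℕ) (Y : ℕ) (X : ℝ) (hX : 0 ≤ X)
    (hP : ∀ p ∈ P, p.Prime ∧ Odd p ∧ p ≤ Y) (hE : ∀ d ∈ E, Squarefree d ∧ (d : ℝ) < 2 * X)
    (hbig : ∀ d ∈ E, (P.card : ℝ) / 4 ≤ |∑ p ∈ P, (J(-(d : ℤ) | p) : ℝ)|)
    (hlarge : 32 * (4 ^ 26 * 13 ^ 13) * X ^ 2 ≤ (P.card : ℝ) ^ 13) (hP0 : 0 < P.card) :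
    (E.card : ℝ) * (P.card : ℝ) ^ 13 ≤ 2 * (4 ^ 26 * 13 ^ 13) * ((Y : ℝ) ^ 13 + 1) := by
  rcases E.eq_empty_or_nonempty with rfl | hne
  · simp only [Finset.card_empty, Nat.cast_zero, zero_mul]
    positivity
  have hE0 : (0 : ℝ) < E.card := by exact_mod_cast hne.card_pos
  have hM0 : (0 : ℝ) < P.card := by exact_mod_cast hP0
  have h := card_biased_le P E Y ⌊2 * X⌋₊ 13 (P.card / 4) (by positivity) hP
    (fun d hd => ⟨(hE d hd).1, Nat.le_floor (hE d hd).2.le⟩) hbig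
  have hD : ((⌊2 * X⌋₊ : ℕ) : ℝ) ≤ 2 * X := Nat.floor_le (by positivity)
  push_cast at h
  set e := (E.card : ℝ)
  set M := (P.card : ℝ)
  have hD2 : ((⌊2 * X⌋₊ : ℕ) : ℝ) ^ 2 ≤ (2 * X) ^ 2 := by gcongr
  have h1 : (e * M ^ 13) * (e * M ^ 13) ≤
      (e * M ^ 13) * ((4 ^ 26 * 13 ^ 13) * ((Y : ℝ) ^ 13 + 1) +
        (4 ^ 26 * 13 ^ 13) * (16 * X ^ 2) * e) := by
    have h2 : M ^ 13 * (13 ^ 13 * (((Y : ℝ) ^ 13 + 1) * e + 4 * (⌊2 * X⌋₊ : ℝ) ^ 2 * e ^ 2)) ≤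
        M ^ 13 * (13 ^ 13 * (((Y : ℝ) ^ 13 + 1) * e + 4 * (2 * X) ^ 2 * e ^ 2)) := by gcongr
    have h3 := h.trans h2
    have h4 : (e * (M / 4) ^ 13) ^ 2 * 4 ^ 26 = (e * M ^ 13) * (e * M ^ 13) := by ring
    rw [← h4]
    calc _ ≤ M ^ 13 * (13 ^ 13 * (((Y : ℝ) ^ 13 + 1) * e + 4 * (2 * X) ^ 2 * e ^ 2)) * 4 ^ 26 := by
          gcongr
      _ = _ := by ring
  have h2 := le_of_mul_le_mul_left h1 (by positivity)
  have h3 : 32 * (4 ^ 26 * 13 ^ 13) * X ^ 2 * e ≤ M ^ 13 * e := by gcongr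
  linarith

set_option maxHeartbeats 1000000 in
open scoped NumberTheorySymbols in
/-- The main estimate, with all small powers of `X = s²` expressed through a parameter `W`. -/
theorem card_large_three_torsion_le {W s y H : ℝ} (hW : 10 ^ 40 ≤ W) (hs : 1 ≤ s) (hy : 0 < y)
    (hyH : y * H = s * W ^ 20) (hys : y ^ 2 * W ^ 40 ≤ s) (hsy : s ^ 2 * W ^ 120 ≤ y ^ 6)
    (hlog : Real.log (s ^ 2) ≤ W)
    (hdiv : ∀ n : ℕ, n ≠ 0 → (n : ℝ) ≤ s ^ 4 → (n.divisors.card : ℝ) ≤ W) (F : Finset ℕ)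
    (hF : ∀ d ∈ F, Squarefree d ∧ s ^ 2 ≤ d ∧ (d : ℝ) < 2 * s ^ 2 ∧ H < hneg 3 d) :
    (F.card : ℝ) ≤ W ^ 27 + W ^ 108 * s ^ 4 / H ^ 5 := by
  classical
  have hW100 : 100 ≤ W := le_trans (by norm_num) hW
  have hW1 : 1 ≤ W := by linarith
  have hW0 : 0 < W := by linarith
  have hs0 : 0 < s := by linarith
  have hH0 : 0 < H := by
    have : 0 < y * H := by rw [hyH]; positivity
    exact (pos_iff_pos_of_mul_pos this).mp hy
  have hWy : W ^ 20 ≤ y := by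
    have h1 : (W ^ 20) ^ 6 ≤ y ^ 6 := by
      calc (W ^ 20) ^ 6 = 1 ^ 2 * W ^ 120 := by ring
        _ ≤ s ^ 2 * W ^ 120 := by gcongr
        _ ≤ y ^ 6 := hsy
    exact le_of_pow_le_pow_left₀ (by norm_num) hy.le h1
  have hWW : W ≤ W ^ 20 := le_self_pow₀ hW1 (by norm_num)
  have hy1 : 100 ≤ y := by linarith
  have hy2s : y ^ 2 * 100 ≤ s := by
    refine le_trans ?_ hys
    gcongr
    exact hW100.trans (le_self_pow₀ hW1 (by norm_num))
  have hys' : 100 * y ≤ s := by nlinarith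
  set Y := ⌊y⌋₊ with hYdef
  have hYy : (Y : ℝ) ≤ y := Nat.floor_le hy.le
  set V := ⌊2 * (Y : ℝ) ^ 3 / s⌋₊ with hVdef
  have hV1 : (V : ℝ) ≤ 2 * (Y : ℝ) ^ 3 / s := Nat.floor_le (by positivity)
  have hV2 : 2 * (Y : ℝ) ^ 3 / s < V + 1 := Nat.lt_floor_add_one _
  have hVy3 : (V : ℝ) ≤ 2 * y ^ 3 / s := hV1.trans (by gcongr)
  have hVW : (V : ℝ) ≤ 2 * y / W ^ 40 := by
    refine hVy3.trans ?_
    rw [div_le_div_iff₀ hs0 (by positivity)]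
    nlinarith
  have hVY' : (V : ℝ) ≤ Y := by
    refine hV1.trans ?_
    rw [div_le_iff₀ hs0]
    have : 2 * (Y : ℝ) ^ 2 ≤ s := by
      have : (Y : ℝ) ^ 2 ≤ y ^ 2 := by gcongr
      linarith [sq_nonneg y]
    nlinarith [(Nat.cast_nonneg Y : (0 : ℝ) ≤ Y)]
  have hVY : V ≤ Y := by exact_mod_cast hVY'
  set P := (Finset.Icc 3 Y).filter fun p => p.Prime ∧ V < p with hPdef
  have hP : ∀ p ∈ P, p.Prime ∧ p ≠ 2 ∧ V < p ∧ p ≤ Y := by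
    intro p hp
    simp only [hPdef, Finset.mem_filter, Finset.mem_Icc] at hp
    exact ⟨hp.2.1, by omega, hp.2.2, hp.1.2⟩
  have hlogs : Real.log (y + 1) ≤ W := by
    refine (Real.log_le_log (by linarith) ?_).trans hlog
    nlinarith
  have hM : y / W ^ 2 ≤ (P.card : ℝ) := card_primes_between_ge hW100 hWy hlogs hVW
  set M := (P.card : ℝ) with hMdef
  have hM18 : W ^ 18 ≤ M := by
    refine le_trans ?_ hM
    rw [le_div_iff₀ (by positivity)]
    calc W ^ 18 * W ^ 2 = W ^ 20 := by ring
      _ ≤ y := hWy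
  have hM1 : 1 ≤ M := (one_le_pow₀ hW1).trans hM18
  have hyM : y ≤ M * W ^ 2 := (div_le_iff₀ (by positivity)).mp hM
  have hWM : W * W ≤ M := by
    refine le_trans ?_ hM18
    rw [← sq]
    exact pow_le_pow_right₀ hW1 (by norm_num)
  -- the exceptional set
  set E := F.filter fun d : ℕ => M / 4 ≤ |∑ p ∈ P, (J(-(d : ℤ) | p) : ℝ)| with hEdef
  set G := F.filter fun d : ℕ => ¬ M / 4 ≤ |∑ p ∈ P, (J(-(d : ℤ) | p) : ℝ)| with hGdef
  have hFEG : (F.card : ℝ) = E.card + G.card := by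
    rw [← Finset.card_filter_add_card_filter_not (s := F)
      (fun d : ℕ => M / 4 ≤ |∑ p ∈ P, (J(-(d : ℤ) | p) : ℝ)|)]
    push_cast
    rfl
  have hM6 : s ^ 2 * W ^ 108 ≤ M ^ 6 := by
    have h1 : s ^ 2 * W ^ 108 * W ^ 12 ≤ M ^ 6 * W ^ 12 := by
      calc s ^ 2 * W ^ 108 * W ^ 12 = s ^ 2 * W ^ 120 := by ring
        _ ≤ y ^ 6 := hsy
        _ ≤ (M * W ^ 2) ^ 6 := by gcongr
        _ = _ := by ring
    exact le_of_mul_le_mul_right h1 (by positivity)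
  have hE : (E.card : ℝ) ≤ W ^ 27 := by
    have h := card_biased_le_of_card_large P E Y (s ^ 2) (by positivity)
      (fun p hp => ⟨(hP p hp).1, (hP p hp).1.odd_of_ne_two (hP p hp).2.1, (hP p hp).2.2.2⟩)
      (fun d hd => by
        have := hF d (Finset.mem_filter.mp hd).1
        exact ⟨this.1, this.2.2.1⟩)
      (fun d hd => (Finset.mem_filter.mp hd).2)
      (by
        have hc : (32 * (4 ^ 26 * 13 ^ 13) : ℝ) ≤ W := le_trans (by norm_num) hW
        calc 32 * (4 ^ 26 * 13 ^ 13) * (s ^ 2) ^ 2 ≤ W * (s ^ 2) ^ 2 := by gcongr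
          _ ≤ W ^ 216 * (s ^ 2) ^ 2 := by
              gcongr
              exact le_self_pow₀ hW1 (by norm_num)
          _ = (s ^ 2 * W ^ 108) ^ 2 := by ring
          _ ≤ (M ^ 6) ^ 2 := by gcongr
          _ = M ^ 12 := by ring
          _ ≤ M ^ 13 := pow_le_pow_right₀ hM1 (by norm_num))
      (by
        have : (0 : ℝ) < P.card := by linarith
        exact_mod_cast this)
    have hc : (4 * (4 ^ 26 * 13 ^ 13) : ℝ) ≤ W := le_trans (by norm_num) hW
    have h1 : (E.card : ℝ) * M ^ 13 ≤ W ^ 27 * M ^ 13 := by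
      refine h.trans ?_
      have h2 : (Y : ℝ) ^ 13 + 1 ≤ 2 * y ^ 13 := by
        have h3 : (Y : ℝ) ^ 13 ≤ y ^ 13 := by gcongr
        have h4 : 1 ≤ y ^ 13 := one_le_pow₀ (by linarith)
        linarith
      calc 2 * (4 ^ 26 * 13 ^ 13) * ((Y : ℝ) ^ 13 + 1)
          ≤ 2 * (4 ^ 26 * 13 ^ 13) * (2 * y ^ 13) := by gcongr
        _ = 4 * (4 ^ 26 * 13 ^ 13) * y ^ 13 := by ring
        _ ≤ W * (M * W ^ 2) ^ 13 := by gcongr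
        _ = _ := by ring
    exact le_of_mul_le_mul_right h1 (by positivity)
  -- the balanced discriminants
  have hs4 : 4 * s ^ 2 ≤ s ^ 4 := by
    have : 4 ≤ s ^ 2 := by nlinarith
    calc 4 * s ^ 2 ≤ s ^ 2 * s ^ 2 := by gcongr
      _ = s ^ 4 := by ring
  have hsqrt : √(2 * s ^ 2) ≤ 2 * s := by
    apply Real.sqrt_le_iff.mpr
    constructor
    · positivity
    · nlinarith
  have hharm : ∑ n ∈ Finset.Icc 1 V, (1 : ℝ) / n ≤ 2 * W := by
    have h1 : ∑ n ∈ Finset.Icc 1 V, (1 : ℝ) / n = (harmonic V : ℝ) := by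
      rw [harmonic_eq_sum_Icc]
      push_cast
      simp only [one_div]
    have h2 : Real.log V ≤ Real.log (y + 1) := by
      rcases Nat.eq_zero_or_pos V with h0 | h0
      · rw [h0, Nat.cast_zero, Real.log_zero]
        exact Real.log_nonneg (by linarith)
      · exact Real.log_le_log (by exact_mod_cast h0) (by linarith)
    have h3 := harmonic_le_one_add_log V
    rw [h1]
    linarith
  have hG : (G.card : ℝ) * M ≤
      80 * W ^ 3 * (Y : ℝ) ^ 3 * V * (∑ n ∈ Finset.Icc 1 V, (1 : ℝ) / n) ^ 2 := by
    apply card_balanced_le P G Y V (s ^ 2) H W (one_le_pow₀ hs) hVY ?_ hP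
      (fun d hd => hF d (Finset.mem_filter.mp hd).1)
      (fun d hd => not_le.mp (Finset.mem_filter.mp hd).2) ?_
      (fun n hn h => hdiv n hn (h.trans hs4)) ?_ hH0 (by nlinarith)
    · rw [div_lt_iff₀ hs0] at hV2
      calc 4 * (Y : ℝ) ^ 6 = (2 * (Y : ℝ) ^ 3) ^ 2 := by ring
        _ < ((V + 1) * s) ^ 2 := by gcongr
        _ = _ := by ring
    · intro n hn h
      apply hdiv n hn
      calc (n : ℝ) ≤ 8 * (Y : ℝ) ^ 3 * (V : ℝ) ^ 2 := by exact_mod_cast h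
        _ ≤ 8 * y ^ 3 * y ^ 2 := by
            gcongr
            exact hVY'.trans hYy
        _ = 8 * (y ^ 2) ^ 2 * y := by ring
        _ ≤ 8 * s ^ 2 * s := by
            gcongr
            · linarith [sq_nonneg y]
            · linarith
        _ = s ^ 3 * 8 := by ring
        _ ≤ s ^ 3 * s := by
            gcongr
            linarith
        _ = s ^ 4 := by ring
    · have h1 : s * W ^ 18 ≤ M * H := by
        have : s * W ^ 18 * W ^ 2 ≤ M * H * W ^ 2 := by
          calc s * W ^ 18 * W ^ 2 = y * H := by rw [hyH]; ring
            _ ≤ M * W ^ 2 * H := by gcongr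
            _ = _ := by ring
        exact le_of_mul_le_mul_right this (by positivity)
      calc 16 * ((2 * √(2 * s ^ 2) + 1) * W) ≤ 16 * ((2 * (2 * s) + s) * W) := by gcongr
        _ = s * (80 * W) := by ring
        _ ≤ s * (W * W) := by gcongr; linarith
        _ ≤ s * W ^ 18 := by
            gcongr
            rw [← sq]
            exact pow_le_pow_right₀ hW1 (by norm_num)
        _ ≤ _ := h1
  have hG' : (G.card : ℝ) ≤ W ^ 108 * s ^ 4 / H ^ 5 := by
    have h1 : (G.card : ℝ) * M ≤ W ^ 6 * y ^ 6 / s := by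
      refine hG.trans ?_
      calc 80 * W ^ 3 * (Y : ℝ) ^ 3 * V * (∑ n ∈ Finset.Icc 1 V, (1 : ℝ) / n) ^ 2
          ≤ 80 * W ^ 3 * y ^ 3 * (2 * y ^ 3 / s) * (2 * W) ^ 2 := by
            gcongr
        _ = 640 * W ^ 5 * y ^ 6 / s := by ring
        _ ≤ W * W ^ 5 * y ^ 6 / s := by
            gcongr
            exact le_trans (by norm_num) hW
        _ = _ := by ring
    have h2 : (G.card : ℝ) * y ≤ W ^ 8 * y ^ 5 / s * y := by
      calc (G.card : ℝ) * y ≤ G.card * (M * W ^ 2) := by gcongr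
        _ = G.card * M * W ^ 2 := by ring
        _ ≤ W ^ 6 * y ^ 6 / s * W ^ 2 := by gcongr
        _ = _ := by ring
    have h3 := le_of_mul_le_mul_right h2 hy
    have h4 : y = s * W ^ 20 / H := by rw [eq_div_iff hH0.ne', hyH]
    refine h3.trans (le_of_eq ?_)
    rw [h4]
    field_simp
  rw [hFEG]
  linarith

theorem card_le_three_mul {X : ℝ} (hX : 1 ≤ X) {F : Finset ℕ}
    (hF : ∀ d ∈ F, (d : ℝ) < 2 * X) : (F.card : ℝ) ≤ 3 * X := by
  have h1 : F ⊆ Finset.range (⌊2 * X⌋₊ + 1) := fun d hd =>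
    Finset.mem_range.mpr (Nat.lt_succ_of_le (Nat.le_floor (hF d hd).le))
  have h2 : (F.card : ℝ) ≤ ⌊2 * X⌋₊ + 1 := by
    have := Finset.card_le_card h1
    rw [Finset.card_range] at this
    exact_mod_cast this
  have h3 : (⌊2 * X⌋₊ : ℝ) ≤ 2 * X := Nat.floor_le (by linarith)
  linarith

open Filter in
theorem exists_forall_card_le (ε : ℝ) (hε : 0 < ε) :
    ∃ X₀ : ℝ, 2 ≤ X₀ ∧ ∀ X H : ℝ, X₀ ≤ X → 1 ≤ H → H ≤ X ^ ((1 : ℝ) / 3) → ∀ F : Finset ℕ,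
      (∀ d ∈ F, Squarefree d ∧ X ≤ d ∧ (d : ℝ) < 2 * X ∧ H < hneg 3 d) →
      (F.card : ℝ) ≤
        3 * X ^ ε * (X ^ ((1 : ℝ) / 2) + X ^ ((7 : ℝ) / 2) * H ^ (-(10 : ℝ))) := by
  obtain ⟨κ, hκ, hκε, hκ1⟩ : ∃ κ : ℝ, 0 < κ ∧ 20 * κ ≤ ε ∧ κ ≤ 1 / 100 :=
    ⟨min (ε / 20) (1 / 100), by positivity, by linarith [min_le_left (ε / 20) (1 / 100 : ℝ)],
      min_le_right _ _⟩
  obtain ⟨C, hC1, hC⟩ := exists_card_divisors_le (κ / 80) (by positivity)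
  have ev1 : ∀ᶠ X : ℝ in atTop, (10 : ℝ) ^ 40 ≤ X ^ (κ / 20) :=
    (tendsto_rpow_atTop (by positivity)).eventually_ge_atTop _
  have ev2 : ∀ᶠ X : ℝ in atTop, C ≤ X ^ (κ / 40) :=
    (tendsto_rpow_atTop (by positivity)).eventually_ge_atTop _
  have ev3 : ∀ᶠ X : ℝ in atTop, Real.log X ≤ X ^ (κ / 20) := by
    filter_upwards [(isLittleO_log_rpow_atTop (show 0 < κ / 20 by positivity)).bound one_pos,
      eventually_ge_atTop 1] with X h hX
    rw [one_mul, Real.norm_of_nonneg (Real.log_nonneg hX),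
      Real.norm_of_nonneg (by positivity)] at h
    exact h
  obtain ⟨X₀, hX₀⟩ := eventually_atTop.mp (ev1.and (ev2.and ev3))
  refine ⟨max X₀ 2, le_max_right _ _, fun X H hX hH1 hH F hF => ?_⟩
  obtain ⟨hW, hCX, hlog⟩ := hX₀ X ((le_max_left _ _).trans hX)
  have hX2 : 2 ≤ X := (le_max_right _ _).trans hX
  have hX1 : 1 ≤ X := by linarith
  have hX0 : 0 < X := by linarith
  have hH0 : 0 < H := by linarith
  have hε1 : 1 ≤ X ^ ε := Real.one_le_rpow hX1 hε.le
  by_cases hsmall : H < X ^ (1 / 4 + 2 * κ)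
  · refine (card_le_three_mul hX1 fun d hd => (hF d hd).2.2.1).trans ?_
    have h1 : X ≤ X ^ ε * (X ^ ((7 : ℝ) / 2) * H ^ (-(10 : ℝ))) := by
      have h2 : (X ^ (1 / 4 + 2 * κ)) ^ (-(10 : ℝ)) ≤ H ^ (-(10 : ℝ)) :=
        Real.rpow_le_rpow_of_nonpos hH0 hsmall.le (by norm_num)
      calc X = X ^ (1 : ℝ) := (Real.rpow_one X).symm
        _ ≤ X ^ (ε + (7 / 2 + (1 / 4 + 2 * κ) * -10)) :=
            Real.rpow_le_rpow_of_exponent_le hX1 (by linarith)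
        _ = X ^ ε * (X ^ ((7 : ℝ) / 2) * (X ^ (1 / 4 + 2 * κ)) ^ (-(10 : ℝ))) := by
            rw [Real.rpow_add hX0, Real.rpow_add hX0, Real.rpow_mul hX0.le]
        _ ≤ _ := by gcongr
    have h3 : 0 ≤ X ^ ε * X ^ ((1 : ℝ) / 2) := by positivity
    nlinarith
  push Not at hsmall
  set s := X ^ ((1 : ℝ) / 2) with hs
  set W := X ^ (κ / 20) with hWdef
  have hW1 : 1 ≤ W := le_trans (by norm_num) hW
  have hW0 : 0 < W := by linarith
  have hs1 : 1 ≤ s := Real.one_le_rpow hX1 (by norm_num)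
  have hs0 : 0 < s := by linarith
  have hsX : ∀ n : ℕ, s ^ n = X ^ ((n : ℝ) / 2) := by
    intro n
    rw [hs, ← Real.rpow_mul_natCast hX0.le]
    congr 1
    ring
  have hWX : ∀ n : ℕ, W ^ n = X ^ (n * κ / 20) := by
    intro n
    rw [hWdef, ← Real.rpow_mul_natCast hX0.le]
    congr 1
    ring
  have hs2 : s ^ 2 = X := by
    rw [hsX]
    norm_num
  have hH2 : s * W ^ 80 ≤ H ^ 2 := by
    calc s * W ^ 80 = (X ^ (1 / 4 + 2 * κ)) ^ 2 := by
          rw [hs, hWX, ← Real.rpow_add hX0, ← Real.rpow_mul_natCast hX0.le]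
          congr 1
          push_cast
          ring
      _ ≤ H ^ 2 := by gcongr
  have hH6 : H ^ 6 ≤ s ^ 4 := by
    calc H ^ 6 ≤ (X ^ ((1 : ℝ) / 3)) ^ 6 := by gcongr
      _ = s ^ 4 := by
          rw [hsX, ← Real.rpow_mul_natCast hX0.le]
          norm_num
  have hmain := card_large_three_torsion_le (y := s * W ^ 20 / H) hW hs1 (by positivity)
    (div_mul_cancel₀ _ hH0.ne') ?_ ?_ (by rwa [hs2]) ?_ F (by rwa [hs2])
  · refine hmain.trans ?_
    have h1 : W ^ 27 ≤ X ^ ε := by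
      rw [hWX]
      apply Real.rpow_le_rpow_of_exponent_le hX1
      push_cast
      linarith
    have h2 : W ^ 108 ≤ X ^ ε := by
      rw [hWX]
      apply Real.rpow_le_rpow_of_exponent_le hX1
      push_cast
      linarith
    have h3 : X ^ ((7 : ℝ) / 2) * H ^ (-(10 : ℝ)) = s ^ 7 / H ^ 10 := by
      rw [hsX, Real.rpow_neg hH0.le, div_eq_mul_inv]
      norm_cast
    rw [h3]
    have h4 : s ^ 4 / H ^ 5 ≤ s + s ^ 7 / H ^ 10 := by
      have : s + s ^ 7 / H ^ 10 - s ^ 4 / H ^ 5 =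
          s * ((s ^ 3 / H ^ 5 - 1 / 2) ^ 2 + 3 / 4) := by
        field_simp
        ring
      have h5 : 0 ≤ s * ((s ^ 3 / H ^ 5 - 1 / 2) ^ 2 + 3 / 4) := by positivity
      linarith
    have h6 : W ^ 108 * s ^ 4 / H ^ 5 ≤ X ^ ε * (s + s ^ 7 / H ^ 10) := by
      rw [mul_div_assoc]
      gcongr
    have h7 : 0 ≤ s ^ 7 / H ^ 10 := by positivity
    have h8 : X ^ ε * 1 ≤ X ^ ε * (s + s ^ 7 / H ^ 10) := by
      gcongr
      linarith
    linarith
  · rw [div_pow, div_mul_eq_mul_div, div_le_iff₀ (by positivity)]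
    calc (s * W ^ 20) ^ 2 * W ^ 40 = s * (s * W ^ 80) := by ring
      _ ≤ s * H ^ 2 := by gcongr
  · rw [div_pow, le_div_iff₀ (by positivity)]
    calc s ^ 2 * W ^ 120 * H ^ 6 ≤ s ^ 2 * W ^ 120 * s ^ 4 := by gcongr
      _ = _ := by ring
  · intro n hn hns
    refine (hC n hn).trans ?_
    calc C * (n : ℝ) ^ (κ / 80) ≤ X ^ (κ / 40) * (s ^ 4) ^ (κ / 80) := by gcongr
      _ = W := by
          rw [hsX, ← Real.rpow_mul hX0.le, ← Real.rpow_add hX0]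
          congr 1
          push_cast
          ring

/-- For every `ε > 0` there is `C = C(ε)` such that for all `X ≥ 2` and all
`1 ≤ H ≤ X^(1/3+ε)`, the number of squarefree `d ∈ [X, 2X)` with `h_3(-d) > H`
is at most `C·X^ε·(X^(1/2) + X^(7/2)·H^(-10))`. -/
theorem N3_bound (ε : ℝ) (hε : 0 < ε) :
    ∃ C : ℝ, 0 < C ∧ ∀ X H : ℝ, 2 ≤ X → 1 ≤ H → H ≤ X ^ ((1 : ℝ) / 3 + ε) →
      (((Finset.range (⌈2 * X⌉₊ + 1)).filter
          (fun d : ℕ => Squarefree d ∧ X ≤ (d : ℝ) ∧ (d : ℝ) < 2 * X ∧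
            H < (hneg 3 d : ℝ))).card : ℝ)
        ≤ C * X ^ ε * (X ^ ((1 : ℝ) / 2) + X ^ ((7 : ℝ) / 2) * H ^ (-(10 : ℝ))) := by
  obtain ⟨X₀, hX₀, h⟩ := exists_forall_card_le ε hε
  refine ⟨6 + 3 * X₀, by linarith, fun X H hX hH _ => ?_⟩
  have hX1 : 1 ≤ X := by linarith
  have hX0 : 0 < X := by linarith
  have hε1 : 1 ≤ X ^ ε := Real.one_le_rpow hX1 hε.le
  have hs1 : 1 ≤ X ^ ((1 : ℝ) / 2) := Real.one_le_rpow hX1 (by norm_num)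
  have hB : 0 ≤ X ^ ((7 : ℝ) / 2) * H ^ (-(10 : ℝ)) := by positivity
  set F := (Finset.range (⌈2 * X⌉₊ + 1)).filter
    (fun d : ℕ => Squarefree d ∧ X ≤ (d : ℝ) ∧ (d : ℝ) < 2 * X ∧ H < (hneg 3 d : ℝ))
  have hF : ∀ d ∈ F, Squarefree d ∧ X ≤ (d : ℝ) ∧ (d : ℝ) < 2 * X ∧ H < (hneg 3 d : ℝ) :=
    fun d hd => (Finset.mem_filter.mp hd).2
  rcases lt_or_ge X X₀ with hXX | hXX
  · calc (F.card : ℝ) ≤ 3 * X := card_le_three_mul hX1 fun d hd => (hF d hd).2.2.1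
      _ ≤ (6 + 3 * X₀) * 1 * (1 + 0) := by linarith
      _ ≤ _ := by gcongr
  have hmono : ∀ A : ℝ, A ≤ 2 * (X ^ ((1 : ℝ) / 2) + X ^ ((7 : ℝ) / 2) * H ^ (-(10 : ℝ))) →
      3 * X ^ ε * A ≤
        (6 + 3 * X₀) * X ^ ε * (X ^ ((1 : ℝ) / 2) + X ^ ((7 : ℝ) / 2) * H ^ (-(10 : ℝ))) := by
    intro A hA
    calc 3 * X ^ ε * A
        ≤ 3 * X ^ ε * (2 * (X ^ ((1 : ℝ) / 2) + X ^ ((7 : ℝ) / 2) * H ^ (-(10 : ℝ)))) := by gcongr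
      _ = 6 * X ^ ε * (X ^ ((1 : ℝ) / 2) + X ^ ((7 : ℝ) / 2) * H ^ (-(10 : ℝ))) := by ring
      _ ≤ _ := by
          gcongr
          linarith
  rcases le_or_gt H (X ^ ((1 : ℝ) / 3)) with hHX | hHX
  · exact (h X H hXX hH hHX F hF).trans (hmono _ (by linarith))
  · refine (h X _ hXX (Real.one_le_rpow hX1 (by norm_num)) le_rfl F fun d hd => ?_).trans
      (hmono _ ?_)
    · have := hF d hd
      exact ⟨this.1, this.2.1, this.2.2.1, hHX.trans this.2.2.2⟩
    · have h1 : X ^ ((7 : ℝ) / 2) * (X ^ ((1 : ℝ) / 3)) ^ (-(10 : ℝ)) ≤ X ^ ((1 : ℝ) / 2) := by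
        rw [← Real.rpow_mul hX0.le, ← Real.rpow_add hX0]
        exact Real.rpow_le_rpow_of_exponent_le hX1 (by norm_num)
      linarith
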